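/- Let O be a W-orbit in ℝ^r and t ∈ T_O. Then: (1) T_i^O(x^{c^O}) = k_i·x^{c^O} for every 1 ≤ i ≤ r with α_i(c^O) = 0, where k_i := k for i < r and k_i := k_r for i = r; (2) Y_i^O(x^{c^O}) = ((𝔰^O·t)_i)^{−1}·x^{c^O} for every 1 ≤ i ≤ r, where 𝔰^O·t is the coordinatewise product in T; (3) F[O] is spanned over F by the elements x^λ·T_{i_1}(⋯(T_{i_ℓ}(x^{c^O}))⋯) with λ ∈ ℤ^r, ℓ ≥ 0 and 1 ≤ i_1,…,i_ℓ ≤ r, i.e., x^{c^O} is a cyclic vector for the algebra of operators on F[O] generated by T_1^O,…,T_r^O and the multiplications by x^λ (λ ∈ ℤ^r). -/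

import Mathlib

open scoped Classical

noncomputable section

namespace QP

/-! ### The space of quasi-polynomials -/

/-- Euclidean space `ℝ^r`. -/
abbrev E (r : ℕ) := Fin r → ℝ

variable (F : Type*) [Field F] [CharZero F] (r : ℕ)

/-- The algebra of quasi-polynomials `F[ℝ^r]`: the group algebra of `(ℝ^r,+)` over `F`. -/
abbrev QA := AddMonoidAlgebra F (E r)

/-- The quasi-monomial `x^y`. -/
def X (y : E r) : QA F r := AddMonoidAlgebra.single y 1

/-- The `i`-th coordinate of a vector (`1`-based). -/
def cd (y : E r) (i : ℕ) : ℝ := ∑ m : Fin r, if (m : ℕ) + 1 = i then y m else 0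

/-- The standard basis vector `ε_i` (`1`-based). -/
def epsV (i : ℕ) : E r := fun m => if (m : ℕ) + 1 = i then 1 else 0

/-- The standard basis vector (`0`-based). -/
def eV (m : Fin r) : E r := fun n => if n = m then 1 else 0

/-- The Euclidean inner product on `ℝ^r`. -/
def ip (v y : E r) : ℝ := ∑ m : Fin r, v m * y m

/-- An integral vector regarded as an element of `ℝ^r`. -/
def zc (lam : Fin r → ℤ) : E r := fun m => (lam m : ℝ)

/-- The simple reflections of the hyperoctahedral group `W₀ = S_r ⋉ (±1)^r` (`1`-based):
for `1 ≤ i < r`, `sW i` interchanges the `i`-th and `(i+1)`-st coordinates, and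
`sW r` negates the last coordinate. -/
def sW (i : ℕ) (y : E r) : E r := fun m =>
  if i = r then (if (m : ℕ) + 1 = r then -y m else y m)
  else if (m : ℕ) + 1 = i then cd r y (i + 1)
  else if (m : ℕ) = i then cd r y i
  else y m

/-- `s_{ε₁} = s₁⋯s_{r-1} s_r s_{r-1}⋯s₁`: negation of the first coordinate. -/
def sEps1 (y : E r) : E r := fun m => if (m : ℕ) = 0 then -y m else y m

/-- The affine simple reflection `s₀ = τ(ε₁) s_{ε₁} : y ↦ (1 - y₁, y₂, …, y_r)`, together
with `genF j = sW j` for `1 ≤ j ≤ r`: the Coxeter generators of the affine Weyl group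
`W = W₀ ⋉ ℤ^r`. -/
def genF (j : ℕ) (y : E r) : E r :=
  if j = 0 then fun m => if (m : ℕ) = 0 then 1 - y m else y m
  else sW r j y

/-- The action of the word `s_{j₁} ⋯ s_{j_ℓ}` on `ℝ^r`. -/
def wordAct (l : List ℕ) (y : E r) : E r := l.foldr (genF r) y

/-- The closure of the fundamental alcove
`C₊ = {y : 0 < y_r < ⋯ < y₁ < 1/2}`. -/
def CplusCl : Set (E r) :=
  {y | (∀ i j : Fin r, i ≤ j → y j ≤ y i) ∧ ∀ m : Fin r, 0 ≤ y m ∧ y m ≤ 1 / 2}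

/-- The `W`-orbit of a point of `ℝ^r`. -/
def orbit (y : E r) : Set (E r) :=
  {z | ∃ l : List ℕ, (∀ a ∈ l, a ≤ r) ∧ wordAct r l y = z}

/-- `O` is a `W`-orbit in `ℝ^r`. -/
def IsOrbit (O : Set (E r)) : Prop := ∃ y, O = orbit r y

/-- `c^𝒪`: the unique point of the orbit `O` lying in the closed fundamental alcove. -/
def cpt (O : Set (E r)) : E r :=
  if h : ∃ c, c ∈ O ∧ c ∈ CplusCl r then h.choose else 0

/-- The length of an element of the affine Weyl group `W` (as a map on `ℝ^r`). -/
def wlen (g : E r → E r) : ℕ :=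
  sInf {n | ∃ l : List ℕ, (∀ a ∈ l, a ≤ r) ∧ l.length = n ∧ (fun y => wordAct r l y) = g}

/-- A choice of a shortest word `l` whose inverse maps `y` into the closed alcove;
the corresponding element of `W` is `g_y`. -/
def gW (y : E r) : List ℕ :=
  if h : ∃ l : List ℕ, (∀ a ∈ l, a ≤ r) ∧ wordAct r l.reverse y ∈ CplusCl r ∧
      ∀ l' : List ℕ, (∀ a ∈ l', a ≤ r) → wordAct r l'.reverse y ∈ CplusCl r →
        l.length ≤ l'.length
  then h.choose else []

/-- `g_y`, the unique shortest element of `W` with `g_y⁻¹ y` in the closed alcove. -/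
def gfun (y : E r) : E r → E r := fun z => wordAct r (gW r y) z

/-- The Bruhat order on `(W, {s₀,…,s_r})`, via the subword characterisation. -/
def bruhatLE (u v : E r → E r) : Prop :=
  ∃ l : List ℕ, (∀ a ∈ l, a ≤ r) ∧ (fun z => wordAct r l z) = v ∧ l.length = wlen r v ∧
    ∃ l' : List ℕ, l'.Sublist l ∧ (fun z => wordAct r l' z) = u ∧ l'.length = wlen r u

/-- The partial order on `ℝ^r`: `y' ≤ y` iff `y'` and `y` lie in the same `W`-orbit and
`g_{y'} ≤_B g_y` in the Bruhat order. -/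
def qle (y' y : E r) : Prop :=
  (∃ l : List ℕ, (∀ a ∈ l, a ≤ r) ∧ wordAct r l y = y') ∧ bruhatLE r (gfun r y') (gfun r y)

/-- Strict version of `qle`. -/
def qlt (y' y : E r) : Prop := qle r y' y ∧ y' ≠ y

/-- The `F`-linear operator on `F[ℝ^r]` determined by its values on the quasi-monomials. -/
def mkOp (Ψ : E r → QA F r) : Module.End F (QA F r) :=
  Finsupp.linearCombination F Ψ ∘ₗ (AddMonoidAlgebra.coeffLinearEquiv F).toLinearMap

/-- `F[O] = span_F {x^y : y ∈ O}`. -/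
def FO (O : Set (E r)) : Submodule F (QA F r) :=
  Submodule.span F {p | ∃ y ∈ O, p = X F r y}

/-- The Laurent polynomial subalgebra `F[ℤ^r] = span_F {x^μ : μ ∈ ℤ^r}`. -/
def Lspan : Submodule F (QA F r) :=
  Submodule.span F {p | ∃ lam : Fin r → ℤ, p = X F r (zc r lam)}

/-- `span_F {x^{y'} : y' < y}`. -/
def ltSpan (y : E r) : Submodule F (QA F r) :=
  Submodule.span F {p | ∃ y', qlt r y' y ∧ p = X F r y'}

/-! ### Floors and indicator/sign functions -/

/-- the largest even integer `≤ z` -/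
def floorE (z : ℝ) : ℤ := 2 * ⌊z / 2⌋
/-- the largest odd integer `≤ z` -/
def floorO (z : ℝ) : ℤ := 2 * ⌊(z + 1) / 2⌋ - 1
/-- indicator of `ℤ ⊆ ℝ` -/
def chiZ (z : ℝ) : ℕ := if ∃ n : ℤ, z = n then 1 else 0
/-- indicator of the even integers -/
def chiE (z : ℝ) : ℕ := if ∃ n : ℤ, z = 2 * n then 1 else 0
/-- indicator of the odd integers -/
def chiO (z : ℝ) : ℕ := if ∃ n : ℤ, z = 2 * n + 1 then 1 else 0
/-- `η_e`: `1` on even integers `≥ 2`, `-1` on even integers `≤ 0`, `0` otherwise -/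
def etaE (z : ℝ) : ℤ := if ∃ n : ℤ, z = 2 * n then (if 2 ≤ z then 1 else -1) else 0
/-- `η_o`: `1` on odd integers `≥ 1`, `-1` on odd integers `≤ -1`, `0` otherwise -/
def etaO (z : ℝ) : ℤ := if ∃ n : ℤ, z = 2 * n + 1 then (if 1 ≤ z then 1 else -1) else 0
/-- `η = η_e + η_o` -/
def eta (z : ℝ) : ℤ := etaE z + etaO z

/-- `geomS c v m` is the truncated geometric series `(1 - (c·x^v)^m)/(1 - c·x^v)`,
a genuine element of `F[ℝ^r]`; it is the unique element with
`(1 - c·x^v) * geomS c v m = 1 - c^m·x^{m v}`. -/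
def geomS (c : F) (v : E r) (m : ℤ) : QA F r :=
  if 0 ≤ m then ∑ t ∈ Finset.range m.toNat, c ^ (t : ℤ) • X F r ((t : ℝ) • v)
  else -∑ t ∈ Finset.range (-m).toNat, c ^ (-(t : ℤ) - 1) • X F r ((-(t : ℝ) - 1) • v)

/-! ### Truncated divided difference operators and Demazure–Lusztig operators -/

/-- `∇_i(x^y) = ((1 - (x_{i+1}/x_i)^{⌊y_i - y_{i+1}⌋})/(1 - x_i/x_{i+1}))·x^y`. -/
def nablaIel (i : ℕ) (y : E r) : QA F r :=
  geomS F r 1 (epsV r i - epsV r (i + 1)) (-⌊cd r y i - cd r y (i + 1)⌋) * X F r y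

/-- `∇_r^e(x^y) = ((1 - x_r^{-⌊2y_r⌋_e})/(1 - x_r^2))·x^y`. -/
def nablaReEl (y : E r) : QA F r :=
  geomS F r 1 ((2 : ℝ) • epsV r r) (-floorE (2 * cd r y r) / 2) * X F r y

/-- `∇_r^o(x^y) = ((x_r - x_r^{-⌊2y_r⌋_o})/(1 - x_r^2))·x^y`. -/
def nablaRoEl (y : E r) : QA F r :=
  X F r (epsV r r) *
    geomS F r 1 ((2 : ℝ) • epsV r r) ((-floorO (2 * cd r y r) - 1) / 2) * X F r y

def nablaIop (i : ℕ) : Module.End F (QA F r) := mkOp F r (nablaIel F r i)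
def nablaReOp : Module.End F (QA F r) := mkOp F r (nablaReEl F r)
def nablaRoOp : Module.End F (QA F r) := mkOp F r (nablaRoEl F r)

/-- The value of the truncated Demazure–Lusztig operator `T_i` (`1 ≤ i ≤ r`) on `x^y`. -/
def Tel (k kr ur : F) (i : ℕ) (y : E r) : QA F r :=
  if i = r then
    (kr ^ chiE (2 * cd r y r) * ur ^ chiO (2 * cd r y r)) • X F r (sW r r y)
      + (kr - kr⁻¹) • nablaReEl F r y + (ur - ur⁻¹) • nablaRoEl F r y
  else
    k ^ chiZ (cd r y i - cd r y (i + 1)) • X F r (sW r i y)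
      + (k - k⁻¹) • nablaIel F r i y

/-- The truncated Demazure–Lusztig operators `T_1, …, T_r` on `F[ℝ^r]`. -/
def Top (k kr ur : F) (i : ℕ) : Module.End F (QA F r) := mkOp F r (Tel F r k kr ur i)

/-! ### The torus and the affine generator -/

/-- `t^{ε_i}`: the `i`-th coordinate (`1`-based) of an element of the torus `T = (Fˣ)^r`. -/
def tcU (t : Fin r → Fˣ) (i : ℕ) : Fˣ := ∏ m : Fin r, if (m : ℕ) + 1 = i then t m else 1

/-- `t^λ` for `λ ∈ ℤ^r`. -/
def upow (t : Fin r → Fˣ) (lam : Fin r → ℤ) : Fˣ := ∏ m : Fin r, t m ^ lam m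

/-- `t^v` for a vector `v` with integral entries (entries read off via the floor). -/
def upowR (t : Fin r → Fˣ) (v : E r) : Fˣ := ∏ m : Fin r, t m ^ ⌊v m⌋

/-- The `W`-action on the torus `T = (Fˣ)^r`: for `g = τ(λ)w₀ ∈ W` (so `g y = w₀ y + λ`),
`(g t)_m = q^{λ_m} · t^{w₀⁻¹ ε_m}`, where `W₀` permutes and inverts coordinates and
`τ(λ) t = q^λ t`, with `q = (q^{1/2})²`. -/
def torusAct (qh : Fˣ) (g : E r → E r) (t : Fin r → Fˣ) : Fin r → Fˣ := fun m =>
  (qh * qh) ^ ⌊g 0 m⌋ * ∏ j : Fin r, t j ^ ⌊(g (eV r j) - g 0) m⌋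

/-- The action on the torus of the linear part of `g` alone (the `W₀`-action). -/
def torusAct0 (g : E r → E r) (t : Fin r → Fˣ) : Fin r → Fˣ := fun m =>
  ∏ j : Fin r, t j ^ ⌊(g (eV r j) - g 0) m⌋

/-- The simple affine roots `α₀(y) = 1 - 2y₁`, `α_i(y) = y_i - y_{i+1}` (`1 ≤ i < r`),
`α_r(y) = 2 y_r` as affine-linear functionals. -/
def alphaF (j : ℕ) (y : E r) : ℝ :=
  if j = 0 then 1 - 2 * cd r y 1
  else if j = r then 2 * cd r y r
  else cd r y j - cd r y (j + 1)

/-- `t^{α_j^∨}` where `α₀^∨ = (-ε₁, 1/2)`, `α_i^∨ = (ε_i - ε_{i+1}, 0)`, `α_r^∨ = (ε_r, 0)`. -/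
def tpowCo (qh : Fˣ) (t : Fin r → Fˣ) (j : ℕ) : Fˣ :=
  if j = 0 then qh * (tcU F r t 1)⁻¹
  else if j = r then tcU F r t r
  else tcU F r t j * (tcU F r t (j + 1))⁻¹

/-- The affine subtorus `T_𝒪 = {t ∈ T : t^{α_j^∨} = 1 whenever α_j(c^𝒪) = 0}`. -/
def TOset (qh : Fˣ) (O : Set (E r)) : Set (Fin r → Fˣ) :=
  {t | ∀ j : ℕ, j ≤ r → alphaF r j (cpt r O) = 0 → tpowCo F r qh t j = 1}

/-- `∇₀^e(x^y) = ((1 - (q^{-1/2}x₁)^{⌊-2y₁⌋_e})/(1 - q x₁^{-2}))·x^y`. -/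
def nabla0eEl (qh : F) (y : E r) : QA F r :=
  geomS F r (qh * qh) ((-2 : ℝ) • epsV r 1) (-floorE (-2 * cd r y 1) / 2) * X F r y

/-- `∇₀^o(x^y) = ((q^{1/2}x₁^{-1} - (q^{-1/2}x₁)^{⌊-2y₁⌋_o})/(1 - q x₁^{-2}))·x^y`. -/
def nabla0oEl (qh : F) (y : E r) : QA F r :=
  (qh • X F r ((-1 : ℝ) • epsV r 1)) *
    geomS F r (qh * qh) ((-2 : ℝ) • epsV r 1) ((-floorO (-2 * cd r y 1) - 1) / 2) * X F r y

/-- The value of `T₀^𝒪` on `x^y`. -/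
def T0el (qh : Fˣ) (k0 u0 : F) (t : Fin r → Fˣ) (y : E r) : QA F r :=
  (k0 ^ chiE (2 * cd r y 1) * u0 ^ chiO (2 * cd r y 1) *
      ((tcU F r (torusAct F r qh (gfun r y) t) 1 : Fˣ) : F)) • X F r (sEps1 r y)
    + (k0 - k0⁻¹) • nabla0eEl F r qh y + (u0 - u0⁻¹) • nabla0oEl F r qh y

/-- The operator `T₀^𝒪` (as a globally defined operator; on `F[𝒪]` it is the operator of
the quasi-polynomial representation). -/
def T0op (qh : Fˣ) (k0 u0 : F) (t : Fin r → Fˣ) : Module.End F (QA F r) :=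
  mkOp F r (T0el F r qh k0 u0 t)

/-- The full family `T₀^𝒪, T₁, …, T_r`. -/
def Tfull (qh : Fˣ) (k0 u0 k kr ur : F) (t : Fin r → Fˣ) (j : ℕ) : Module.End F (QA F r) :=
  if j = 0 then T0op F r qh k0 u0 t else Top F r k kr ur j

/-- The Hecke parameter `k_j` (`k₀`, `k` or `k_r`). -/
def kpar (k0 k kr : F) (j : ℕ) : F := if j = 0 then k0 else if j = r then kr else k

/-- `(T_j^𝒪)⁻¹ = T_j^𝒪 - k_j + k_j⁻¹` (the inverse on `F[𝒪]`, by the Hecke relation). -/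
def TfullInv (qh : Fˣ) (k0 u0 k kr ur : F) (t : Fin r → Fˣ) (j : ℕ) : Module.End F (QA F r) :=
  Tfull F r qh k0 u0 k kr ur t j - (kpar F r k0 k kr j - (kpar F r k0 k kr j)⁻¹) • 1

/-- The word `0, 1, …, r-1, r, r-1, …, i` used in the definition of `Y_i^𝒪`. -/
def Ylist (i : ℕ) : List ℕ :=
  0 :: (((List.range (r - 1)).map (· + 1)) ++ [r] ++ ((List.range (r - i)).map fun m => r - 1 - m))

/-- The commuting operators
`Y_i^𝒪 = (T_{i-1}^𝒪)⁻¹⋯(T₁^𝒪)⁻¹ · T₀^𝒪 · T₁^𝒪⋯T_{r-1}^𝒪 · T_r^𝒪 · T_{r-1}^𝒪⋯T_i^𝒪`. -/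
def Yop (qh : Fˣ) (k0 u0 k kr ur : F) (t : Fin r → Fˣ) (i : ℕ) : Module.End F (QA F r) :=
  ((((List.range (i - 1)).map (· + 1)).reverse.map (TfullInv F r qh k0 u0 k kr ur t)).prod) *
    (((Ylist r i).map (Tfull F r qh k0 u0 k kr ur t)).prod)

/-! ### The base points `𝔰^𝒪`, `𝔰_y` and the spectrum -/

/-- `n_i^𝒪` (with `c = c^𝒪`), resp. `m_i(y)` (with `c = y`). -/
def nO (c : E r) (m : Fin r) : ℤ :=
  (∑ j : Fin r, if m < j then eta (c m - c j) + eta (c m + c j) else 0) +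
    ∑ j : Fin r, if j < m then eta (c j + c m) - eta (c j - c m) else 0

/-- The base point `𝔰^𝒪 ∈ T`. -/
def sOtor (k0 u0 k kr ur : Fˣ) (O : Set (E r)) : Fin r → Fˣ := fun m =>
  (k0 * kr) ^ (-(chiE (2 * cpt r O m) : ℤ)) * (u0 * ur) ^ (chiO (2 * cpt r O m) : ℤ) *
    k ^ nO r (cpt r O) m

/-- The eigenvalue `γ_i^𝒪(y) = ((g_y(𝔰^𝒪·t))_i)⁻¹`. -/
def gammaO (qh k0 u0 k kr ur : Fˣ) (O : Set (E r)) (t : Fin r → Fˣ) (i : ℕ) (y : E r) : Fˣ :=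
  (tcU F r (torusAct F r qh (gfun r y) fun m => sOtor F r k0 u0 k kr ur O m * t m) i)⁻¹

/-- `𝔰_y ∈ T`. -/
def sfrak (k0 u0 k kr ur : Fˣ) (y : E r) : Fin r → Fˣ := fun m =>
  (k0 * kr) ^ etaE (2 * y m) * (u0 * ur) ^ etaO (2 * y m) * k ^ nO r y m

/-! ### Finite Weyl group combinatorics, positive roots -/

/-- The set of positive roots of type `C_r`. -/
def PhiPlus : Set (E r) :=
  {v | (∃ a b : Fin r, a < b ∧ v = eV r a - eV r b) ∨
       (∃ a b : Fin r, a < b ∧ v = eV r a + eV r b) ∨ ∃ a : Fin r, v = (2 : ℝ) • eV r a}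

/-- The root system of type `C_r`. -/
def Phi0 : Set (E r) := PhiPlus r ∪ {v | -v ∈ PhiPlus r}

/-- The normalisation factor `κ_w^𝒪 = ∏_{α ∈ Π(w)} 𝐤_α^{χ_e(α(c))}·𝐤_{α/2}^{-χ_o(α(c))}`,
where `Π(w) = {α ∈ Φ₀⁺ : wα ∈ -Φ₀⁺}`, `𝐤_α = 𝐤_{α/2} = k` for short roots and
`𝐤_α = k_r`, `𝐤_{α/2} = u_r` for long roots. -/
def kappaW (k kr ur : Fˣ) (w : E r → E r) (c : E r) : Fˣ :=
  (∏ p : Fin r × Fin r,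
      if p.1 < p.2 ∧ -w (eV r p.1 - eV r p.2) ∈ PhiPlus r then
        k ^ ((chiE (ip r (eV r p.1 - eV r p.2) c) : ℤ) - (chiO (ip r (eV r p.1 - eV r p.2) c) : ℤ))
      else 1) *
  (∏ p : Fin r × Fin r,
      if p.1 < p.2 ∧ -w (eV r p.1 + eV r p.2) ∈ PhiPlus r then
        k ^ ((chiE (ip r (eV r p.1 + eV r p.2) c) : ℤ) - (chiO (ip r (eV r p.1 + eV r p.2) c) : ℤ))
      else 1) *
  ∏ a : Fin r,
      if -w ((2 : ℝ) • eV r a) ∈ PhiPlus r then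
        kr ^ (chiE (ip r ((2 : ℝ) • eV r a) c) : ℤ) * ur ^ (-(chiO (ip r ((2 : ℝ) • eV r a) c) : ℤ))
      else 1

/-- Iterated application `T_{i₁}(T_{i₂}(⋯(T_{i_ℓ}(f))⋯))`. -/
def applyT (k kr ur : F) (l : List ℕ) (f : QA F r) : QA F r :=
  l.foldr (fun i g => Top F r k kr ur i g) f

/-- The length function of the finite Weyl group `W₀`. -/
def w0len (g : E r → E r) : ℕ :=
  sInf {n | ∃ l : List ℕ, (∀ a ∈ l, 1 ≤ a ∧ a ≤ r) ∧ l.length = n ∧ (fun y => wordAct r l y) = g}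

/-- Membership in `W₀` (as maps on `ℝ^r`). -/
def IsW0fun (w : E r → E r) : Prop :=
  ∃ l : List ℕ, (∀ a ∈ l, 1 ≤ a ∧ a ≤ r) ∧ w = fun y => wordAct r l y

/-- Membership in the parabolic subgroup `W_{0,𝒪}` generated by the `s_i`, `1 ≤ i ≤ r`,
with `α_i(c^𝒪) = 0`. -/
def IsWOOfun (O : Set (E r)) (u : E r → E r) : Prop :=
  ∃ l : List ℕ, (∀ a ∈ l, 1 ≤ a ∧ a ≤ r ∧ alphaF r a (cpt r O) = 0) ∧
    u = fun y => wordAct r l y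

/-- `v ∈ W₀^𝒪`: `v ∈ W₀` of minimal length in its coset `v·W_{0,𝒪}`. -/
def MinRep (O : Set (E r)) (v : E r → E r) : Prop :=
  IsW0fun r v ∧ ∀ u, IsWOOfun r O u → w0len r v ≤ w0len r fun y => v (u y)

/-- Membership in the affine Weyl group `W` (as maps on `ℝ^r`). -/
def IsWfun (g : E r → E r) : Prop :=
  ∃ l : List ℕ, (∀ a ∈ l, a ≤ r) ∧ g = fun y => wordAct r l y

/-- Membership in the parabolic subgroup `W_{J(𝒪)}` generated by the `s_j`, `j ∈ J(𝒪)`. -/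
def IsWJfun (O : Set (E r)) (u : E r → E r) : Prop :=
  ∃ l : List ℕ, (∀ a ∈ l, a ≤ r ∧ alphaF r a (cpt r O) = 0) ∧ u = fun y => wordAct r l y

/-- The `W`-action on the Laurent polynomials `F[ℤ^r]` by `q`-dilations and reflections:
`w(x^μ) = x^{wμ}` for `w ∈ W₀`, `τ(λ)(x^μ) = q^{-⟨μ,λ⟩} x^μ` (globally defined via the
linear/translation parts of `g`). -/
def LWact (qh : Fˣ) (g : E r → E r) : Module.End F (QA F r) :=
  mkOp F r fun v => (((qh * qh) ^ (-⌊ip r (g v - g 0) (g 0)⌋) : Fˣ) : F) • X F r (g v - g 0)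

/-! ### roots `ᾱ_j`, torus reflections -/

/-- The finite simple roots `ᾱ₀ = -2ε₁`, `ᾱ_i = ε_i - ε_{i+1}`, `ᾱ_r = 2ε_r`
(as integral vectors). -/
def abarI (j : ℕ) : Fin r → ℤ := fun m =>
  if j = 0 then (if (m : ℕ) = 0 then -2 else 0)
  else if j = r then (if (m : ℕ) + 1 = r then 2 else 0)
  else if (m : ℕ) + 1 = j then 1
  else if (m : ℕ) = j then -1
  else 0

/-- The corresponding coroots `ᾱ₀^∨ = -ε₁`, `ᾱ_i^∨ = ε_i - ε_{i+1}`, `ᾱ_r^∨ = ε_r`. -/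
def abarV (j : ℕ) : Fin r → ℤ := fun m =>
  if j = 0 then (if (m : ℕ) = 0 then -1 else 0)
  else if j = r then (if (m : ℕ) + 1 = r then 1 else 0)
  else if (m : ℕ) + 1 = j then 1
  else if (m : ℕ) = j then -1
  else 0

/-- `ᾱ_j` as a real vector. -/
def abarR (j : ℕ) : E r := fun m => ((abarI r j m : ℤ) : ℝ)

/-- The constants `c₀ = u₀u_r`, `c_i = k²`, `c_r = k₀k_r`. -/
def cpar (k0 u0 k kr ur : Fˣ) (j : ℕ) : Fˣ :=
  if j = 0 then u0 * ur else if j = r then k0 * kr else k * k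

/-- The action of the reflection `s_{ᾱ_j} ∈ W₀` on the torus `T` (with `s_{ᾱ₀} = s_{ε₁}`). -/
def sTor (j : ℕ) (t : Fin r → Fˣ) : Fin r → Fˣ := fun m =>
  if j = 0 then (if (m : ℕ) = 0 then (t m)⁻¹ else t m)
  else if j = r then (if (m : ℕ) + 1 = r then (t m)⁻¹ else t m)
  else if (m : ℕ) + 1 = j then tcU F r t (j + 1)
  else if (m : ℕ) = j then tcU F r t j
  else t m

/-! ### The operators `G_t^𝒪(a)` for affine roots `a = (α, n)` -/

/-- The coroot `α^∨ = 2α/⟨α,α⟩`. -/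
def coroot (v : E r) : E r := ((2 : ℝ) / ip r v v) • v

/-- The scalar `q^{2n/⟨α,α⟩}` appearing in `x^{a^∨}` for `a = (α,n)`. -/
def qsc (qh : Fˣ) (v : E r) (n : ℤ) : Fˣ := if ip r v v = 4 then qh ^ n else (qh * qh) ^ n

/-- `𝐤_a`: `k` if `α` is short; `k_r` if `α` long, `n` even; `k₀` if `α` long, `n` odd. -/
def kaf (k0 k kr : Fˣ) (v : E r) (n : ℤ) : Fˣ :=
  if ip r v v = 4 then (if Even n then kr else k0) else k

/-- `𝐤_{a/2}`: `k` if `α` is short; `u_r` if `α` long, `n` even; `u₀` if `α` long, `n` odd. -/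
def khaf (u0 k ur : Fˣ) (v : E r) (n : ℤ) : Fˣ :=
  if ip r v v = 4 then (if Even n then ur else u0) else k

/-- The reflection `s_α(y) = y - α(y)·α^∨`. -/
def sRefl (v y : E r) : E r := y - ip r v y • coroot r v

/-- `s_{a,t}(x^y) = (g_y t)^{-n α^∨} · x^{s_α y}`. -/
def saTel (qh : Fˣ) (t : Fin r → Fˣ) (v : E r) (n : ℤ) (y : E r) : QA F r :=
  ((upowR F r (torusAct F r qh (gfun r y) t) (((-n : ℤ) : ℝ) • coroot r v) : Fˣ) : F) •
    X F r (sRefl r v y)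

/-- The twisted reflection operator `s_{a,t}`. -/
def SaOp (qh : Fˣ) (t : Fin r → Fˣ) (v : E r) (n : ℤ) : Module.End F (QA F r) :=
  mkOp F r (saTel F r qh t v n)

/-- The value `G_t^𝒪(a)(x^y)` for the affine root `a = (v, n)`. -/
def Gel (qh k0 u0 k kr ur : Fˣ) (t : Fin r → Fˣ) (v : E r) (n : ℤ) (y : E r) : QA F r :=
  (((kaf F r k0 k kr v n : Fˣ) : F) ^ chiE (ip r v y) *
      ((khaf F r u0 k ur v n : Fˣ) : F) ^ chiO (ip r v y)) • X F r y
    + ((((kaf F r k0 k kr v n : Fˣ) : F) - ((kaf F r k0 k kr v n : Fˣ) : F)⁻¹) •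
          geomS F r (((qsc F r qh v n)⁻¹ * (qsc F r qh v n)⁻¹ : Fˣ) : F)
            ((-2 : ℝ) • coroot r v) (-floorE (ip r v y) / 2)
        + (((khaf F r u0 k ur v n : Fˣ) : F) - ((khaf F r u0 k ur v n : Fˣ) : F)⁻¹) •
          ((((qsc F r qh v n)⁻¹ : Fˣ) : F) • X F r ((-1 : ℝ) • coroot r v) *
            geomS F r (((qsc F r qh v n)⁻¹ * (qsc F r qh v n)⁻¹ : Fˣ) : F)
              ((-2 : ℝ) • coroot r v) (-(floorO (ip r v y) + 1) / 2))) *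
      saTel F r qh t v n y

/-- The operator `G_t^𝒪(a)` for `a = (v, n)`. -/
def Gop (qh k0 u0 k kr ur : Fˣ) (t : Fin r → Fˣ) (v : E r) (n : ℤ) : Module.End F (QA F r) :=
  mkOp F r (Gel F r qh k0 u0 k kr ur t v n)

/-- The twisted action `g_t` of `g ∈ W` on `F[𝒪]`:
`g_t(x^y) = (g_{w₀ y} t)^{-λ} x^{w₀ y}` for `g = τ(λ) w₀`. -/
def Wtw (qh : Fˣ) (t : Fin r → Fˣ) (g : E r → E r) : Module.End F (QA F r) :=
  mkOp F r fun y =>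
    (((upowR F r (torusAct F r qh (gfun r (g y - g 0)) t) (g 0))⁻¹ : Fˣ) : F) •
      X F r (g y - g 0)

/-! ### The operators `D_j` -/

/-- The palindromic word `1, …, r-1, r, r-1, …, 1`. -/
def palin : List ℕ :=
  ((List.range (r - 1)).map (· + 1)) ++ [r] ++ ((List.range (r - 1)).map (· + 1)).reverse

/-- Multiplication by `x^{-ε₁}`. -/
def Mop : Module.End F (QA F r) := mkOp F r fun y => X F r ((-1 : ℝ) • epsV r 1) * X F r y

/-- `D₀ = (T₁^𝒪 ⋯ T_{r-1}^𝒪 T_r^𝒪 T_{r-1}^𝒪 ⋯ T₁^𝒪)⁻¹ ∘ M`. -/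
def D0op (qh : Fˣ) (k0 u0 k kr ur : F) (t : Fin r → Fˣ) : Module.End F (QA F r) :=
  ((palin r).map (TfullInv F r qh k0 u0 k kr ur t)).prod * Mop F r

/-- `D_j`: `D₀` for `j = 0` and `T_j^𝒪` for `1 ≤ j ≤ r`. -/
def Dop (qh : Fˣ) (k0 u0 k kr ur : F) (t : Fin r → Fˣ) (j : ℕ) : Module.End F (QA F r) :=
  if j = 0 then D0op F r qh k0 u0 k kr ur t else Tfull F r qh k0 u0 k kr ur t j

/-- Iterated application `D_{j₁}(D_{j₂}(⋯(D_{j_ℓ}(f))⋯))`. -/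
def applyD (qh : Fˣ) (k0 u0 k kr ur : F) (t : Fin r → Fˣ) (l : List ℕ) (f : QA F r) : QA F r :=
  l.foldr (fun j g => Dop F r qh k0 u0 k kr ur t j g) f

/-- The coefficients `k_{s_j}(y)`. -/
def ksj (k kr ur : Fˣ) (j : ℕ) (y : E r) : Fˣ :=
  if j = 0 then
    kr ^ (-etaE (2 * cd r y 1)) * ur ^ (-etaO (2 * cd r y 1)) *
      ∏ m : Fin r,
        (if 1 ≤ (m : ℕ) then k ^ (-eta (cd r y 1 - y m) - eta (cd r y 1 + y m)) else 1)
  else if j = r then kr ^ (-etaE (2 * cd r y r)) * ur ^ (-etaO (2 * cd r y r))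
  else k ^ (-eta (cd r y j - cd r y (j + 1)))

/-- `k_w(c) = ∏_m k_{s_{j_m}}(s_{j_{m+1}} ⋯ s_{j_ℓ} c)` for the word `w = s_{j₁} ⋯ s_{j_ℓ}`. -/
def kword (k kr ur : Fˣ) (l : List ℕ) (z : E r) : Fˣ :=
  (l.foldr (fun j p => (genF r j p.1, ksj F r k kr ur j p.1 * p.2)) (z, (1 : Fˣ))).2



set_option linter.unusedSectionVars false

/-! ### Helper lemmas: coordinates and words -/

lemma cd_eq (y : E r) (m : Fin r) : cd r y ((m : ℕ) + 1) = y m := by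
  unfold cd
  rw [Finset.sum_eq_single m]
  · simp
  · intro b _ hb
    rw [if_neg]
    intro h
    exact hb (Fin.ext (by omega))
  · simp

lemma cd_eq' (y : E r) (j : ℕ) (hj : j < r) : cd r y (j + 1) = y ⟨j, hj⟩ :=
  cd_eq r y ⟨j, hj⟩

lemma sW_last (y : E r) (m : Fin r) :
    sW r r y m = if (m : ℕ) + 1 = r then -y m else y m := by
  simp [sW]

lemma sW_mid (y : E r) (j : ℕ) (hj : j + 1 < r) :
    sW r (j + 1) y = y ∘ (Equiv.swap (⟨j, by omega⟩ : Fin r) ⟨j + 1, hj⟩) := by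
  funext m
  simp only [sW, Function.comp]
  rw [if_neg (by omega)]
  by_cases h1 : (m : ℕ) = j
  · have : m = ⟨j, by omega⟩ := Fin.ext h1
    rw [if_pos (by omega), this, Equiv.swap_apply_left, cd_eq' r y (j + 1) hj]
  · rw [if_neg (by omega)]
    by_cases h2 : (m : ℕ) = j + 1
    · have : m = ⟨j + 1, hj⟩ := Fin.ext h2
      rw [if_pos h2, this, Equiv.swap_apply_right, cd_eq' r y j (by omega)]
    · rw [if_neg h2, Equiv.swap_apply_of_ne_of_ne]
      · intro h; exact h1 (by rw [h])
      · intro h; exact h2 (by rw [h])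

lemma genF_zero (y : E r) (m : Fin r) :
    genF r 0 y m = if (m : ℕ) = 0 then 1 - y m else y m := by
  unfold genF; simp

lemma genF_pos (j : ℕ) (hj : 1 ≤ j) (y : E r) : genF r j y = sW r j y := by
  unfold genF; rw [if_neg (by omega)]

/-- The generators are involutions. -/
lemma genF_invol (j : ℕ) (hj : j ≤ r) (y : E r) : genF r j (genF r j y) = y := by
  rcases Nat.eq_zero_or_pos j with h0 | h0
  · subst h0
    funext m
    rw [genF_zero, genF_zero]
    split_ifs <;> ring
  · rw [genF_pos r j h0, genF_pos r j h0]
    rcases Nat.lt_or_ge j r with h | h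
    · obtain ⟨i, rfl⟩ : ∃ i, j = i + 1 := ⟨j - 1, by omega⟩
      rw [sW_mid r _ i h, sW_mid r _ i h]
      funext m; simp
    · obtain rfl : j = r := by omega
      funext m
      rw [sW_last, sW_last]
      split_ifs <;> ring

lemma wordAct_cons (a : ℕ) (l : List ℕ) (y : E r) :
    wordAct r (a :: l) y = genF r a (wordAct r l y) := rfl

lemma wordAct_append (l l' : List ℕ) (y : E r) :
    wordAct r (l ++ l') y = wordAct r l (wordAct r l' y) := by
  unfold wordAct; rw [List.foldr_append]

lemma wordAct_reverse (l : List ℕ) (hl : ∀ a ∈ l, a ≤ r) (y : E r) :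
    wordAct r l.reverse (wordAct r l y) = y := by
  induction l generalizing y with
  | nil => rfl
  | cons a l ih =>
    rw [List.reverse_cons, wordAct_append]
    have : wordAct r [a] (genF r a (wordAct r l y)) = wordAct r l y :=
      genF_invol r a (hl a (by simp)) _
    change wordAct r l.reverse (wordAct r [a] (genF r a (wordAct r l y))) = y
    rw [this]
    exact ih (fun b hb => hl b (by simp [hb])) y

lemma wordAct_reverse' (l : List ℕ) (hl : ∀ a ∈ l, a ≤ r) (y : E r) :
    wordAct r l (wordAct r l.reverse y) = y := by
  have := wordAct_reverse r l.reverse (fun a ha => hl a (by simpa using ha)) y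
  simpa using this

/-- Every generator acts as a signed permutation plus integral translation. -/
lemma genF_form (j : ℕ) (hj : j ≤ r) : ∃ (p : Equiv.Perm (Fin r)) (s : Fin r → ℤ)
    (lam : Fin r → ℤ), (∀ m, s m = 1 ∨ s m = -1) ∧
      ∀ y m, genF r j y m = (s m : ℝ) * y (p m) + (lam m : ℝ) := by
  rcases Nat.eq_zero_or_pos j with h0 | h0
  · subst h0
    refine ⟨1, fun m => if (m : ℕ) = 0 then -1 else 1,
      fun m => if (m : ℕ) = 0 then 1 else 0, fun m => ?_, fun y m => ?_⟩
    · dsimp only; split_ifs <;> simp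
    · rw [genF_zero]; dsimp only; split_ifs
      · push_cast; simp; ring
      · simp
  · rcases Nat.lt_or_ge j r with h | h
    · obtain ⟨i, rfl⟩ : ∃ i, j = i + 1 := ⟨j - 1, by omega⟩
      refine ⟨Equiv.swap (⟨i, by omega⟩ : Fin r) ⟨i + 1, h⟩, fun _ => 1, fun _ => 0,
        fun m => Or.inl rfl, fun y m => ?_⟩
      rw [genF_pos r _ h0, sW_mid r y i h]; simp
    · obtain rfl : j = r := by omega
      refine ⟨1, fun m => if (m : ℕ) + 1 = j then -1 else 1, fun _ => 0,
        fun m => ?_, fun y m => ?_⟩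
      · dsimp only; split_ifs <;> simp
      · rw [genF_pos j _ h0, sW_last]; dsimp only; split_ifs <;> simp

/-- Every word acts as a signed permutation plus integral translation. -/
lemma word_form (l : List ℕ) (hl : ∀ a ∈ l, a ≤ r) : ∃ (p : Equiv.Perm (Fin r)) (s : Fin r → ℤ)
    (lam : Fin r → ℤ), (∀ m, s m = 1 ∨ s m = -1) ∧
      ∀ y m, wordAct r l y m = (s m : ℝ) * y (p m) + (lam m : ℝ) := by
  induction l with
  | nil => exact ⟨1, fun _ => 1, fun _ => 0, fun m => Or.inl rfl, fun y m => by simp [wordAct]⟩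
  | cons a l ih =>
    obtain ⟨p, s, lam, hs, h⟩ := ih (fun b hb => hl b (by simp [hb]))
    obtain ⟨p', s', lam', hs', h'⟩ := genF_form r a (hl a (by simp))
    refine ⟨p'.trans p, fun m => s' m * s (p' m), fun m => s' m * lam (p' m) + lam' m,
      fun m => ?_, fun y m => ?_⟩
    · rcases hs' m with h1 | h1 <;> rcases hs (p' m) with h2 | h2 <;> simp [h1, h2]
    · rw [wordAct_cons, h', h]; push_cast; simp; ring

/-- `g` is realised by a word with letters in `[b, r]`. -/
def Wd (b : ℕ) (g : E r → E r) : Prop :=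
  ∃ l : List ℕ, (∀ a ∈ l, b ≤ a ∧ a ≤ r) ∧ ∀ y, wordAct r l y = g y

lemma Wd.comp {r b : ℕ} {g h : E r → E r} (hg : Wd r b g) (hh : Wd r b h) :
    Wd r b (fun y => g (h y)) := by
  obtain ⟨l, hl, hl'⟩ := hg
  obtain ⟨l2, hl2, hl2'⟩ := hh
  refine ⟨l ++ l2, fun a ha => ?_, fun y => by rw [wordAct_append, hl', hl2']⟩
  rcases List.mem_append.1 ha with h | h
  · exact hl a h
  · exact hl2 a h

lemma Wd.id (b : ℕ) : Wd r b (fun y => y) := ⟨[], by simp, fun _ => rfl⟩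

lemma Wd.gen {r b : ℕ} (j : ℕ) (hb : b ≤ j) (hj : j ≤ r) : Wd r b (genF r j) :=
  ⟨[j], by simp [hb, hj], fun _ => rfl⟩

lemma Wd.mono {r b : ℕ} {g : E r → E r} (hg : Wd r b g) : Wd r 0 g := by
  obtain ⟨l, hl, hl'⟩ := hg
  exact ⟨l, fun a ha => ⟨by omega, (hl a ha).2⟩, hl'⟩

lemma Wd.congr {r b : ℕ} {g h : E r → E r} (hg : Wd r b g) (e : ∀ y m, g y m = h y m) :
    Wd r b h := by
  have : g = h := by funext y m; exact e y m
  rwa [← this]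

lemma Wd_perm (p : Equiv.Perm (Fin r)) : Wd r 1 (fun y => y ∘ p) := by
  rcases r with _ | n
  · exact (Wd.id 0 1).congr (fun y m => m.elim0)
  · have hp : p ∈ Submonoid.closure
        (Set.range fun i : Fin n => Equiv.swap i.castSucc i.succ) := by
      rw [Equiv.Perm.mclosure_swap_castSucc_succ]; trivial
    induction hp using Submonoid.closure_induction with
    | mem x hx =>
      obtain ⟨i, rfl⟩ := hx
      refine (Wd.gen (r := n + 1) ((i : ℕ) + 1) (by omega) (by omega)).congr (fun y m => ?_)
      rw [genF_pos _ _ (by omega), sW_mid _ _ _ (by omega)]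
      rfl
    | one => exact Wd.id _ _
    | mul x y _ _ hx hy => exact hy.comp hx

/-- negate the coordinate `m` -/
def negAt (m : Fin r) (y : E r) : E r := fun n => if n = m then -y n else y n

lemma Wd_negAt (m : Fin r) : Wd r 1 (negAt r m) := by
  have hr : 0 < r := Nat.lt_of_le_of_lt (Nat.zero_le _) m.2
  have h1 := Wd_perm r (Equiv.swap m ⟨r - 1, by omega⟩)
  have h2 : Wd r 1 (genF r r) := Wd.gen r (by omega) le_rfl
  refine (h1.comp (h2.comp h1)).congr (fun y n => ?_)
  rw [genF_pos r r (by omega)]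
  simp only [Function.comp, negAt]
  rw [sW_last]
  simp only [Function.comp, Equiv.swap_apply_self]
  have : ((Equiv.swap m (⟨r - 1, by omega⟩ : Fin r) n : Fin r) : ℕ) + 1 = r ↔ n = m := by
    constructor
    · intro h
      have : Equiv.swap m (⟨r - 1, by omega⟩ : Fin r) n = ⟨r - 1, by omega⟩ :=
        Fin.ext (by simp only; omega)
      rw [Equiv.swap_apply_eq_iff, Equiv.swap_apply_right] at this
      exact this
    · rintro rfl
      rw [Equiv.swap_apply_left]
      simp only; omega
  by_cases h : n = m
  · rw [if_pos (this.2 h), if_pos h]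
  · rw [if_neg (fun h' => h (this.1 h')), if_neg h]

lemma Wd_signs (S : Finset (Fin r)) :
    Wd r 1 (fun y n => if n ∈ S then -y n else y n) := by
  induction S using Finset.induction_on with
  | empty => exact (Wd.id r 1).congr (by simp)
  | insert a S ha ih =>
    refine ((Wd_negAt r a).comp ih).congr (fun y n => ?_)
    simp only [negAt, Finset.mem_insert]
    by_cases h : n = a
    · subst h; simp [ha]
    · simp [h]

lemma Wd_signed (p : Equiv.Perm (Fin r)) (s : Fin r → ℤ) (hs : ∀ m, s m = 1 ∨ s m = -1) :
    Wd r 1 (fun y m => (s m : ℝ) * y (p m)) := by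
  refine ((Wd_signs r (Finset.univ.filter (fun m => s m = -1))).comp (Wd_perm r p)).congr
    (fun y m => ?_)
  rcases hs m with h | h <;> simp [h]

/-- translate the coordinate `m` by `z` -/
def trAt (m : Fin r) (z : ℤ) (y : E r) : E r := fun n => if n = m then y n + z else y n

lemma Wd_trAt (m : Fin r) (z : ℤ) : Wd r 0 (trAt r m z) := by
  have hr : 0 < r := Nat.lt_of_le_of_lt (Nat.zero_le _) m.2
  have h1 := (Wd_perm r (Equiv.swap m ⟨0, hr⟩)).mono
  have h2 : Wd r 0 (genF r 0) := Wd.gen 0 le_rfl (by omega)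
  have h3 := (Wd_negAt r m).mono
  have key : ∀ n : Fin r, ((Equiv.swap m (⟨0, hr⟩ : Fin r) n : Fin r) : ℕ) = 0 ↔ n = m := by
    intro n
    constructor
    · intro h
      have : Equiv.swap m (⟨0, hr⟩ : Fin r) n = ⟨0, hr⟩ := Fin.ext h
      rw [Equiv.swap_apply_eq_iff, Equiv.swap_apply_right] at this
      exact this
    · rintro rfl
      rw [Equiv.swap_apply_left]
  have h4 : Wd r 0 (fun y n => if n = m then 1 - y n else y n) := by
    refine (h1.comp (h2.comp h1)).congr (fun y n => ?_)
    simp only [Function.comp]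
    rw [genF_zero]
    simp only [Function.comp, Equiv.swap_apply_self, key]
  have hp : Wd r 0 (trAt r m 1) := by
    refine (h4.comp h3).congr (fun y n => ?_)
    simp only [negAt, trAt]; split_ifs
    · push_cast; ring
    · rfl
  have hm : Wd r 0 (trAt r m (-1)) := by
    refine (h3.comp h4).congr (fun y n => ?_)
    simp only [negAt, trAt]; split_ifs
    · push_cast; ring
    · rfl
  induction z using Int.induction_on with
  | zero => exact (Wd.id r 0).congr (fun y n => by simp [trAt])
  | succ i ih =>
    refine (hp.comp ih).congr (fun y n => ?_)
    simp only [trAt]; split_ifs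
    · push_cast; ring
    · rfl
  | pred i ih =>
    refine (hm.comp ih).congr (fun y n => ?_)
    simp only [trAt]; split_ifs
    · push_cast; ring
    · rfl

lemma Wd_trans (lam : Fin r → ℤ) : Wd r 0 (fun y => y + zc r lam) := by
  have : ∀ S : Finset (Fin r), Wd r 0 (fun y n => if n ∈ S then y n + lam n else y n) := by
    intro S
    induction S using Finset.induction_on with
    | empty => exact (Wd.id r 0).congr (by simp)
    | insert a S ha ih =>
      refine ((Wd_trAt r a (lam a)).comp ih).congr (fun y n => ?_)
      simp only [trAt, Finset.mem_insert]
      by_cases h : n = a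
      · subst h; simp [ha]
      · simp [h]
  exact (this Finset.univ).congr (fun y n => by simp [zc])

/-! ### Orbits and the closed alcove -/

lemma orbit_Wd {r b : ℕ} {y z : E r} {g : E r → E r} (hg : Wd r b g) (hz : z ∈ orbit r y) :
    g z ∈ orbit r y := by
  obtain ⟨l, hl, hl'⟩ := hg
  obtain ⟨l2, hl2, hl2'⟩ := hz
  refine ⟨l ++ l2, fun a ha => ?_, by rw [wordAct_append, hl2', hl']⟩
  rcases List.mem_append.1 ha with h | h
  · exact (hl a h).2
  · exact hl2 a h

lemma orbit_self (y : E r) : y ∈ orbit r y := ⟨[], by simp, rfl⟩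

lemma exists_alcove (y : E r) : ∃ c, c ∈ orbit r y ∧ c ∈ CplusCl r := by
  have h1 : ∀ z : ℝ, ∃ (s lam : ℤ), (s = 1 ∨ s = -1) ∧ 0 ≤ (s : ℝ) * z + lam ∧
      (s : ℝ) * z + lam ≤ 1 / 2 := by
    intro z
    have hf := abs_sub_round z
    rcases le_total 0 (z - round z) with h | h
    · refine ⟨1, -round z, Or.inl rfl, ?_, ?_⟩
      · push_cast; linarith
      · rw [abs_of_nonneg h] at hf; push_cast; linarith
    · refine ⟨-1, round z, Or.inr rfl, ?_, ?_⟩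
      · push_cast; linarith
      · rw [abs_of_nonpos h] at hf; push_cast; linarith
  choose s lam hs h0 h2 using h1
  have hw := (Wd_trans r (fun m => lam (y m))).comp
    (Wd_signed r 1 (fun m => s (y m)) (fun m => hs _)).mono
  set y' : E r := fun m => (s (y m) : ℝ) * y m + lam (y m) with hy'
  have hy : y' ∈ orbit r y := orbit_Wd hw (orbit_self r y)
  set p := Tuple.sort (fun m => - y' m)
  have hp : Monotone ((fun m => - y' m) ∘ p) := Tuple.monotone_sort _
  refine ⟨y' ∘ p, orbit_Wd (Wd_perm r p) hy, ⟨fun i j hij => ?_, fun m => ⟨h0 _, h2 _⟩⟩⟩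
  have := hp hij
  simp only [Function.comp] at this ⊢
  linarith

lemma cpt_spec {r : ℕ} {O : Set (E r)} (hO : IsOrbit r O) : cpt r O ∈ O ∧ cpt r O ∈ CplusCl r := by
  obtain ⟨y, rfl⟩ := hO
  unfold cpt
  rw [dif_pos (exists_alcove r y)]
  exact (exists_alcove r y).choose_spec

lemma orbit_eq {r : ℕ} {O : Set (E r)} (hO : IsOrbit r O) {c : E r} (hc : c ∈ O) :
    O = orbit r c := by
  obtain ⟨y, rfl⟩ := hO
  obtain ⟨l, hl, rfl⟩ := hc
  ext z
  constructor
  · rintro ⟨l2, hl2, rfl⟩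
    refine ⟨l2 ++ l.reverse, fun a ha => ?_, ?_⟩
    · rcases List.mem_append.1 ha with h | h
      · exact hl2 a h
      · exact hl a (by simpa using h)
    · rw [wordAct_append, wordAct_reverse r l hl]
  · rintro ⟨l2, hl2, rfl⟩
    refine ⟨l2 ++ l, fun a ha => ?_, ?_⟩
    · rcases List.mem_append.1 ha with h | h
      · exact hl2 a h
      · exact hl a h
    · rw [wordAct_append]

/-- coordinates in `[0,1/2]` related by a sign and a translation -/
lemma coord_cases {a b : ℝ} (ha : 0 ≤ a) (ha' : a ≤ 1 / 2) (hb : 0 ≤ b) (hb' : b ≤ 1 / 2)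
    {s lam : ℤ} (hs : s = 1 ∨ s = -1) (h : a = s * b + lam) :
    a = b ∧ ((s = 1 ∧ lam = 0) ∨ (s = -1 ∧ lam = 0 ∧ a = 0) ∨ (s = -1 ∧ lam = 1 ∧ a = 1 / 2)) := by
  rcases hs with rfl | rfl
  · have h1 : (lam : ℝ) < 1 := by push_cast at h; linarith
    have h2 : (-1 : ℝ) < lam := by push_cast at h; linarith
    have h3 : lam < 1 := by exact_mod_cast h1
    have h4 : -1 < lam := by exact_mod_cast h2
    obtain rfl : lam = 0 := by omega
    push_cast at h
    exact ⟨by linarith, Or.inl ⟨rfl, rfl⟩⟩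
  · have h1 : (lam : ℝ) < 2 := by push_cast at h; linarith
    have h2 : (-1 : ℝ) < lam := by push_cast at h; linarith
    have h3 : lam < 2 := by exact_mod_cast h1
    have h4 : -1 < lam := by exact_mod_cast h2
    have h5 : lam = 0 ∨ lam = 1 := by omega
    rcases h5 with rfl | rfl
    · push_cast at h
      exact ⟨by linarith, Or.inr (Or.inl ⟨rfl, rfl, by linarith⟩)⟩
    · push_cast at h
      exact ⟨by linarith, Or.inr (Or.inr ⟨rfl, rfl, by linarith⟩)⟩

lemma alcove_unique {r : ℕ} {c c' : E r} (hc : c ∈ CplusCl r) (hc' : c' ∈ CplusCl r)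
    (h : c' ∈ orbit r c) : c' = c := by
  obtain ⟨l, hl, hl'⟩ := h
  obtain ⟨p, s, lam, hs, hf⟩ := word_form r l hl
  have e : ∀ m, c' m = c (p m) := by
    intro m
    have := hf c m
    rw [hl'] at this
    exact (coord_cases (hc'.2 m).1 (hc'.2 m).2 (hc.2 _).1 (hc.2 _).2 (hs m) this).1
  have h1 : Monotone ((fun m => - c m) ∘ p) := by
    intro i j hij
    have := hc'.1 i j hij
    simp only [Function.comp]
    rw [← e, ← e]; linarith
  have h2 : Monotone ((fun m => - c m) ∘ (1 : Equiv.Perm (Fin r))) := by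
    intro i j hij
    have := hc.1 i j hij
    simp only [Function.comp, Equiv.Perm.coe_one, id]
    linarith
  have h3 := Tuple.unique_monotone h1 h2
  funext m
  have := congrFun h3 m
  simp only [Function.comp, Equiv.Perm.coe_one, id] at this
  rw [e]; linarith

/-- `g_y c = y`. -/
lemma gfun_spec {r : ℕ} {c y : E r} (hc : c ∈ CplusCl r) (hy : y ∈ orbit r c) :
    (∀ a ∈ gW r y, a ≤ r) ∧ wordAct r (gW r y) c = y := by
  have hex : ∃ l : List ℕ, (∀ a ∈ l, a ≤ r) ∧ wordAct r l.reverse y ∈ CplusCl r ∧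
      ∀ l' : List ℕ, (∀ a ∈ l', a ≤ r) → wordAct r l'.reverse y ∈ CplusCl r →
        l.length ≤ l'.length := by
    have h0 : ∃ n, ∃ l : List ℕ, l.length = n ∧ (∀ a ∈ l, a ≤ r) ∧
        wordAct r l.reverse y ∈ CplusCl r := by
      obtain ⟨l, hl, rfl⟩ := hy
      exact ⟨_, l, rfl, hl, by rw [wordAct_reverse r l hl]; exact hc⟩
    obtain ⟨l, h1, h2, h3⟩ := Nat.find_spec h0
    refine ⟨l, h2, h3, fun l' h4 h5 => ?_⟩
    rw [h1]
    exact Nat.find_min' h0 ⟨l', rfl, h4, h5⟩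
  have hg : gW r y = hex.choose := by unfold gW; rw [dif_pos hex]
  have hsp := hex.choose_spec
  rw [← hg] at hsp
  obtain ⟨h1, h2, -⟩ := hsp
  refine ⟨h1, ?_⟩
  have h3 : wordAct r (gW r y).reverse y ∈ orbit r c := by
    refine orbit_Wd (b := 0) ⟨(gW r y).reverse, fun a ha => ⟨by omega, h1 a (by simpa using ha)⟩, fun _ => rfl⟩ hy
  have h4 := alcove_unique hc h2 h3
  rw [← h4, wordAct_reverse' r _ h1]


/-! ### The torus -/

lemma tcU_eq (t : Fin r → Fˣ) (m : Fin r) : tcU F r t ((m : ℕ) + 1) = t m := by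
  unfold tcU
  rw [Finset.prod_eq_single m]
  · simp
  · intro b _ hb
    rw [if_neg]
    intro h
    exact hb (Fin.ext (by omega))
  · simp

lemma tcU_eq' (t : Fin r → Fˣ) (j : ℕ) (hj : j < r) : tcU F r t (j + 1) = t ⟨j, hj⟩ :=
  tcU_eq F r t ⟨j, hj⟩

lemma torusAct_form (qh : Fˣ) (g : E r → E r) (t : Fin r → Fˣ) (p : Equiv.Perm (Fin r))
    (s lam : Fin r → ℤ)
    (hf : ∀ y m, g y m = (s m : ℝ) * y (p m) + (lam m : ℝ)) (m : Fin r) :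
    torusAct F r qh g t m = (qh * qh) ^ lam m * t (p m) ^ s m := by
  unfold torusAct
  have h0 : ⌊g 0 m⌋ = lam m := by rw [hf]; simp
  rw [h0]
  congr 1
  rw [Finset.prod_eq_single (p m)]
  · have : (g (eV r (p m)) - g 0) m = ((s m : ℤ) : ℝ) := by
      rw [Pi.sub_apply, hf, hf]; simp [eV]
    rw [this, Int.floor_intCast]
  · intro b _ hb
    have : (g (eV r b) - g 0) m = ((0 : ℤ) : ℝ) := by
      rw [Pi.sub_apply, hf, hf]; simp [eV, hb.symm]
    rw [this, Int.floor_intCast, zpow_zero]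
  · simp

/-- For `t ∈ T_𝒪`, equal coordinates of `c` give equal coordinates of `t`. -/
lemma TO_eq {F : Type*} [Field F] [CharZero F] {r : ℕ} {qh : Fˣ} {O : Set (E r)} (hO : IsOrbit r O)
    {t : Fin r → Fˣ} (ht : t ∈ TOset F r qh O) (i j : Fin r) (hij : i ≤ j)
    (h : cpt r O i = cpt r O j) : t i = t j := by
  have hc := (cpt_spec hO).2
  obtain ⟨i, hi⟩ := i
  obtain ⟨j, hj⟩ := j
  have hij' : i ≤ j := hij
  obtain ⟨n, rfl⟩ := Nat.exists_eq_add_of_le hij'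
  clear hij hij'
  induction n with
  | zero => rfl
  | succ n ih =>
    have h1 := hc.1 ⟨i, hi⟩ ⟨i + n, by omega⟩ (by simp)
    have h2 := hc.1 ⟨i + n, by omega⟩ ⟨i + (n + 1), by omega⟩ (by simp)
    rw [ih (by omega) (le_antisymm (by linarith) h1)]
    have h3 := ht (i + n + 1) (by omega) (by
      unfold alphaF
      rw [if_neg (by omega), if_neg (by omega), cd_eq' r _ (i + n) (by omega),
        cd_eq' r _ (i + n + 1) (by omega)]
      have : (⟨i + n + 1, by omega⟩ : Fin r) = ⟨i + (n + 1), by omega⟩ := rfl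
      rw [this]; linarith)
    unfold tpowCo at h3
    rw [if_neg (by omega), if_neg (by omega), tcU_eq' F r t (i + n) (by omega),
        tcU_eq' F r t (i + n + 1) (by omega)] at h3
    exact mul_inv_eq_one.1 h3

lemma TO_zero {F : Type*} [Field F] [CharZero F] {r : ℕ} {qh : Fˣ} {O : Set (E r)} (hO : IsOrbit r O)
    {t : Fin r → Fˣ} (ht : t ∈ TOset F r qh O) (i : Fin r)
    (h : cpt r O i = 0) : t i = 1 := by
  have hc := (cpt_spec hO).2
  have hi := i.2
  have h1 := hc.1 i ⟨r - 1, by omega⟩ (Fin.mk_le_mk.2 (by omega) : i ≤ ⟨r - 1, by omega⟩)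
  have h2 := (hc.2 ⟨r - 1, by omega⟩).1
  rw [TO_eq hO ht i ⟨r - 1, by omega⟩ (Fin.mk_le_mk.2 (by omega) : i ≤ ⟨r - 1, by omega⟩)
    (by linarith)]
  have hr : r = (r - 1) + 1 := by omega
  have h3 := ht r le_rfl (by
    unfold alphaF
    rw [if_neg (by omega), if_pos rfl]
    have : cd r (cpt r O) r = cpt r O ⟨r - 1, by omega⟩ := by
      have := cd_eq' r (cpt r O) (r - 1) (by omega)
      rwa [← hr] at this
    rw [this]; linarith)
  unfold tpowCo at h3
  rw [if_neg (by omega), if_pos rfl] at h3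
  have := tcU_eq' F r t (r - 1) (by omega)
  rw [← hr] at this
  rw [← this, h3]

lemma TO_half {F : Type*} [Field F] [CharZero F] {r : ℕ} {qh : Fˣ} {O : Set (E r)} (hO : IsOrbit r O)
    {t : Fin r → Fˣ} (ht : t ∈ TOset F r qh O) (i : Fin r)
    (h : cpt r O i = 1 / 2) : t i = qh := by
  have hc := (cpt_spec hO).2
  have hi := i.2
  have h1 := hc.1 ⟨0, by omega⟩ i (Fin.mk_le_mk.2 (by omega) : ⟨0, by omega⟩ ≤ i)
  have h2 := (hc.2 ⟨0, by omega⟩).2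
  rw [← TO_eq hO ht ⟨0, by omega⟩ i (Fin.mk_le_mk.2 (by omega) : ⟨0, by omega⟩ ≤ i)
    (by linarith)]
  have h3 := ht 0 (by omega) (by
    unfold alphaF
    rw [if_pos rfl]
    have : cd r (cpt r O) 1 = cpt r O ⟨0, by omega⟩ := cd_eq' r (cpt r O) 0 (by omega)
    rw [this]; linarith)
  unfold tpowCo at h3
  rw [if_pos rfl] at h3
  have := tcU_eq' F r t 0 (by omega)
  rw [← this]
  exact (mul_inv_eq_one.1 h3).symm

/-- The value `(g_y t)_m` when `y_m = -c_i`. -/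
lemma torus_val {F : Type*} [Field F] [CharZero F] {r : ℕ} {qh : Fˣ} {O : Set (E r)} (hO : IsOrbit r O)
    {t : Fin r → Fˣ} (ht : t ∈ TOset F r qh O) {y : E r} (hy : y ∈ O) (m i : Fin r)
    (h : y m = - cpt r O i) : torusAct F r qh (gfun r y) t m = (t i)⁻¹ := by
  obtain ⟨hcO, hc⟩ := cpt_spec hO
  rw [orbit_eq hO hcO] at hy
  obtain ⟨h1, h2⟩ := gfun_spec hc hy
  obtain ⟨p, s, lam, hs, hf⟩ := word_form r _ h1
  rw [torusAct_form F r qh (gfun r y) t p s lam hf m]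
  have h3 := hf (cpt r O) m
  rw [h2, h] at h3
  have h4 : cpt r O i = ((-s m : ℤ) : ℝ) * cpt r O (p m) + ((-lam m : ℤ) : ℝ) := by
    push_cast; linarith
  have hs' : -s m = 1 ∨ -s m = -1 := by rcases hs m with h | h <;> omega
  obtain ⟨h5, h6⟩ := coord_cases (hc.2 i).1 (hc.2 i).2 (hc.2 (p m)).1 (hc.2 (p m)).2 hs' h4
  have h7 : t (p m) = t i := by
    rcases le_total (p m) i with h | h
    · exact TO_eq hO ht _ _ h h5.symm
    · exact (TO_eq hO ht _ _ h h5).symm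
  rw [h7]
  rcases h6 with ⟨ha, hb⟩ | ⟨ha, hb, hd⟩ | ⟨ha, hb, hd⟩
  · have e1 : s m = -1 := by omega
    have e2 : lam m = 0 := by omega
    rw [e1, e2]; simp
  · have e1 : s m = 1 := by omega
    have e2 : lam m = 0 := by omega
    rw [e1, e2, TO_zero hO ht i hd]; simp
  · have e1 : s m = 1 := by omega
    have e2 : lam m = -1 := by omega
    rw [e1, e2, TO_half hO ht i hd]; simp

/-! ### Values of the operators on quasi-monomials -/

lemma mkOp_X (Ψ : E r → QA F r) (y : E r) : mkOp F r Ψ (X F r y) = Ψ y := by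
  simp [mkOp, X]

lemma X_mul (y z : E r) : X F r y * X F r z = X F r (y + z) := by
  simp [X, AddMonoidAlgebra.single_mul_single]

lemma geomS_zero (c : F) (v : E r) : geomS F r c v 0 = 0 := by
  simp [geomS]

lemma X_zero : X F r 0 = 1 := rfl

lemma geomS_one (c : F) (v : E r) : geomS F r c v 1 = 1 := by
  simp [geomS, X_zero]

lemma geomS_neg_one (c : F) (v : E r) : geomS F r c v (-1) = -(c⁻¹ • X F r (-v)) := by
  simp [geomS]

lemma chiZ_int (n : ℤ) : chiZ (n : ℝ) = 1 := if_pos ⟨n, rfl⟩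

lemma not_int {z : ℝ} {m : ℤ} (h1 : (m : ℝ) < z) (h2 : z < m + 1) (n : ℤ) : z ≠ n := by
  intro h
  rw [h] at h1 h2
  have h1' : m < n := by exact_mod_cast h1
  have h2' : n < m + 1 := by exact_mod_cast h2
  omega

lemma chiZ_not {z : ℝ} {m : ℤ} (h1 : (m : ℝ) < z) (h2 : z < m + 1) : chiZ z = 0 :=
  if_neg (fun ⟨n, hn⟩ => not_int h1 h2 n hn)

lemma chiE_not {z : ℝ} {m : ℤ} (h1 : (m : ℝ) < z) (h2 : z < m + 1) : chiE z = 0 :=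
  if_neg (fun ⟨n, hn⟩ => not_int h1 h2 (2 * n) (by rw [hn]; push_cast; ring))

lemma chiO_not {z : ℝ} {m : ℤ} (h1 : (m : ℝ) < z) (h2 : z < m + 1) : chiO z = 0 :=
  if_neg (fun ⟨n, hn⟩ => not_int h1 h2 (2 * n + 1) (by rw [hn]; push_cast; ring))

lemma chiE_zero : chiE 0 = 1 := if_pos ⟨0, by simp⟩
lemma chiO_zero : chiO 0 = 0 := if_neg (by
  rintro ⟨n, hn⟩
  have : (0 : ℤ) = 2 * n + 1 := by exact_mod_cast hn
  omega)
lemma chiE_one : chiE 1 = 0 := if_neg (by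
  rintro ⟨n, hn⟩
  have : (1 : ℤ) = 2 * n := by exact_mod_cast hn
  omega)
lemma chiO_one : chiO 1 = 1 := if_pos ⟨0, by simp⟩
lemma chiE_neg (z : ℝ) : chiE (-z) = chiE z := by
  unfold chiE
  congr 1
  apply propext
  constructor
  · rintro ⟨n, hn⟩; exact ⟨-n, by push_cast; linarith⟩
  · rintro ⟨n, hn⟩; exact ⟨-n, by push_cast; linarith⟩
lemma chiO_neg (z : ℝ) : chiO (-z) = chiO z := by
  unfold chiO
  congr 1
  apply propext
  constructor
  · rintro ⟨n, hn⟩; exact ⟨-n - 1, by push_cast; linarith⟩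
  · rintro ⟨n, hn⟩; exact ⟨-n - 1, by push_cast; linarith⟩

lemma eta_zero : eta 0 = -1 := by
  unfold eta etaE etaO
  rw [if_pos ⟨0, by simp⟩, if_neg (by norm_num), if_neg]
  · rfl
  · rintro ⟨n, hn⟩
    have : (0 : ℤ) = 2 * n + 1 := by exact_mod_cast hn
    omega

lemma eta_one : eta 1 = 1 := by
  unfold eta etaE etaO
  rw [if_neg, if_pos ⟨0, by simp⟩, if_pos le_rfl]
  · rfl
  · rintro ⟨n, hn⟩
    have : (1 : ℤ) = 2 * n := by exact_mod_cast hn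
    omega

lemma eta_not {z : ℝ} {m : ℤ} (h1 : (m : ℝ) < z) (h2 : z < m + 1) : eta z = 0 := by
  unfold eta etaE etaO
  rw [if_neg (fun ⟨n, hn⟩ => not_int h1 h2 (2 * n) (by rw [hn]; push_cast; ring)),
    if_neg (fun ⟨n, hn⟩ => not_int h1 h2 (2 * n + 1) (by rw [hn]; push_cast; ring))]
  rfl

lemma floorE_val {z : ℝ} (n : ℤ) (h1 : (2 * n : ℝ) ≤ z) (h2 : z < 2 * n + 2) :
    floorE z = 2 * n := by
  have h : ⌊z / 2⌋ = n := Int.floor_eq_iff.2 ⟨by linarith, by linarith⟩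
  unfold floorE
  rw [h]

lemma floorO_val {z : ℝ} (n : ℤ) (h1 : (2 * n - 1 : ℝ) ≤ z) (h2 : z < 2 * n + 1) :
    floorO z = 2 * n - 1 := by
  have h : ⌊(z + 1) / 2⌋ = n := Int.floor_eq_iff.2 ⟨by linarith, by linarith⟩
  unfold floorO
  rw [h]

lemma Top_X (k kr ur : F) (i : ℕ) (y : E r) :
    Top F r k kr ur i (X F r y) = Tel F r k kr ur i y := mkOp_X _ _ _ _

/-- The swap as a translation, when the difference of the coordinates is one. -/
lemma sW_eq_sub (y : E r) (j : ℕ) (hj : j + 1 < r) :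
    sW r (j + 1) y =
      -((cd r y (j + 1) - cd r y (j + 2)) • (epsV r (j + 1) - epsV r (j + 2))) + y := by
  funext m
  have h1 := cd_eq' r y j (by omega)
  have h2 := cd_eq' r y (j + 1) hj
  simp only [sW, Pi.add_apply, Pi.neg_apply, Pi.smul_apply, Pi.sub_apply, epsV, smul_eq_mul]
  rw [if_neg (by omega)]
  by_cases h : (m : ℕ) = j
  · have e : y m = cd r y (j + 1) := by rw [h1]; congr 1; exact Fin.ext h
    simp [h, e]
  · by_cases h' : (m : ℕ) = j + 1
    · have e : y m = cd r y (j + 1 + 1) := by rw [h2]; congr 1; exact Fin.ext h'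
      simp [h', e]
    · simp [h, h']

lemma sW_last_sub (hr : 1 ≤ r) (y : E r) :
    sW r r y = -((2 * cd r y r) • epsV r r) + y := by
  funext m
  have h1 := cd_eq' r y (r - 1) (by omega)
  rw [show r - 1 + 1 = r by omega] at h1
  rw [sW_last]
  simp only [Pi.add_apply, Pi.neg_apply, Pi.smul_apply, epsV, smul_eq_mul]
  by_cases h : (m : ℕ) + 1 = r
  · have e : y m = cd r y r := by
      rw [h1]; congr 1; exact Fin.ext (by simp only; omega)
    simp [h, e]; ring
  · simp [h]

lemma sEps1_sub (hr : 1 ≤ r) (y : E r) :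
    sEps1 r y = -((2 * cd r y 1) • epsV r 1) + y := by
  funext m
  have h1 := cd_eq' r y 0 (by omega)
  simp only [sEps1, Pi.add_apply, Pi.neg_apply, Pi.smul_apply, epsV, smul_eq_mul]
  by_cases h : (m : ℕ) = 0
  · have e : y m = cd r y 1 := by
      rw [zero_add] at h1
      rw [h1]; congr 1; exact Fin.ext h
    simp [h, e]; ring
  · simp [h]

/-- `T_{j+1}` in the dominant direction. -/
lemma T_up (k kr ur : Fˣ) (j : ℕ) (hj : j + 1 < r) (y : E r)
    (h0 : 0 ≤ cd r y (j + 1) - cd r y (j + 2)) (h1 : cd r y (j + 1) - cd r y (j + 2) ≤ 1) :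
    Top F r (k : F) kr ur (j + 1) (X F r y) =
      ((k ^ (-eta (cd r y (j + 1) - cd r y (j + 2))) : Fˣ) : F) • X F r (sW r (j + 1) y) := by
  rw [Top_X]
  unfold Tel nablaIel
  rw [if_neg (by omega)]
  have hs := sW_eq_sub r y j hj
  change k.val ^ chiZ (cd r y (j + 1) - cd r y (j + 2)) • X F r (sW r (j + 1) y) +
    ((k : F) - (k : F)⁻¹) • (geomS F r 1 (epsV r (j + 1) - epsV r (j + 2))
      (-⌊cd r y (j + 1) - cd r y (j + 2)⌋) * X F r y) = _
  generalize cd r y (j + 1) - cd r y (j + 2) = a at *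
  rcases h1.lt_or_eq with h | h
  · have hf : ⌊a⌋ = 0 := Int.floor_eq_iff.2 ⟨by simpa using h0, by simpa using h⟩
    rw [hf, neg_zero, geomS_zero]
    rcases h0.lt_or_eq with h' | h'
    · rw [chiZ_not (m := 0) (by simpa using h') (by simpa using h),
        eta_not (m := 0) (by simpa using h') (by simpa using h)]
      simp
    · have := chiZ_int 0
      rw [Int.cast_zero] at this
      rw [← h', this, eta_zero]; simp
  · subst h
    have := chiZ_int 1
    rw [Int.cast_one] at this
    rw [this, eta_one, Int.floor_one, geomS_neg_one, neg_mul, smul_mul_assoc, X_mul, hs, one_smul,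
      inv_one, one_smul, smul_neg, ← sub_eq_add_neg, ← sub_smul]
    simp

/-- `T_{j+1}` in the antidominant direction. -/
lemma T_down (k kr ur : F) (j : ℕ) (hj : j + 1 < r) (y : E r)
    (h0 : -1 ≤ cd r y (j + 1) - cd r y (j + 2)) (h1 : cd r y (j + 1) - cd r y (j + 2) < 0) :
    Top F r k kr ur (j + 1) (X F r y) =
      k ^ chiZ (cd r y (j + 1) - cd r y (j + 2)) • X F r (sW r (j + 1) y)
      + (k - k⁻¹) • X F r y := by
  rw [Top_X]
  unfold Tel nablaIel
  rw [if_neg (by omega)]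
  have hf : ⌊cd r y (j + 1) - cd r y (j + 1 + 1)⌋ = -1 :=
    Int.floor_eq_iff.2 ⟨by push_cast; exact h0, by push_cast; rw [neg_add_cancel]; exact h1⟩
  rw [hf, neg_neg, geomS_one, one_mul]

/-- `T_r` in the dominant direction. -/
lemma T_last_up (hr : 1 ≤ r) (k kr ur : Fˣ) (y : E r)
    (h0 : 0 ≤ cd r y r) (h1 : cd r y r ≤ 1 / 2) :
    Top F r (k : F) kr ur r (X F r y) =
      ((kr ^ chiE (2 * cd r y r) * (ur ^ chiO (2 * cd r y r))⁻¹ : Fˣ) : F) •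
        X F r (sW r r y) := by
  rw [Top_X]
  unfold Tel nablaReEl nablaRoEl
  rw [if_pos rfl]
  have hs := sW_last_sub r hr y
  have hE : floorE (2 * cd r y r) = 2 * 0 :=
    floorE_val 0 (by push_cast; linarith) (by push_cast; linarith)
  rw [hE]
  simp only [mul_zero, neg_zero, Int.zero_ediv, geomS_zero, zero_mul, smul_zero, add_zero]
  rcases h1.lt_or_eq with h | h
  · have hO : floorO (2 * cd r y r) = 2 * 0 - 1 :=
      floorO_val 0 (by push_cast; linarith) (by push_cast; linarith)
    rw [hO]
    norm_num
    rw [geomS_zero]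
    rcases h0.lt_or_eq with h' | h'
    · rw [chiE_not (m := 0) (by push_cast; linarith) (by push_cast; linarith),
        chiO_not (m := 0) (by push_cast; linarith) (by push_cast; linarith)]
      simp
    · rw [← h', mul_zero, chiE_zero, chiO_zero]; simp
  · have hO : floorO (2 * cd r y r) = 2 * 1 - 1 :=
      floorO_val 1 (by push_cast; linarith) (by push_cast; linarith)
    rw [hO]
    have e : 2 * cd r y r = 1 := by linarith
    rw [e] at hs ⊢
    rw [show (-(2 * 1 - 1 : ℤ) - 1) / 2 = -1 by norm_num, geomS_neg_one, chiE_one, chiO_one,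
      inv_one, one_smul, mul_neg, neg_mul, X_mul, X_mul, smul_neg,
      show epsV r r + -((2 : ℝ) • epsV r r) + y = sW r r y by rw [hs]; module,
      ← sub_eq_add_neg, ← sub_smul]
    simp

/-- `T_r` in the antidominant direction. -/
lemma T_last_down (k kr ur : F) (y : E r)
    (h0 : -(1 / 2) ≤ cd r y r) (h1 : cd r y r < 0) :
    Top F r k kr ur r (X F r y) =
      (kr ^ chiE (2 * cd r y r) * ur ^ chiO (2 * cd r y r)) • X F r (sW r r y)
        + (kr - kr⁻¹) • X F r y := by
  rw [Top_X]
  unfold Tel nablaReEl nablaRoEl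
  rw [if_pos rfl]
  have hE : floorE (2 * cd r y r) = 2 * (-1) :=
    floorE_val (-1) (by push_cast; linarith) (by push_cast; linarith)
  have hO : floorO (2 * cd r y r) = 2 * 0 - 1 :=
    floorO_val 0 (by push_cast; linarith) (by push_cast; linarith)
  rw [hE, hO]
  norm_num
  rw [geomS_zero, geomS_one]
  simp

/-- `T_0` on `x^y` for `-1/2 ≤ y_1 ≤ 0`. -/
lemma T0_val (hr : 1 ≤ r) (qh k0 u0 : Fˣ) (t : Fin r → Fˣ) (y : E r) (a : Fˣ)
    (h0 : -(1 / 2) ≤ cd r y 1) (h1 : cd r y 1 ≤ 0)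
    (ha : tcU F r (torusAct F r qh (gfun r y) t) 1 = a)
    (hq : cd r y 1 = -(1 / 2) → a = qh⁻¹) :
    T0op F r qh k0 u0 t (X F r y) =
      ((k0 ^ chiE (2 * cd r y 1) * (u0 ^ chiO (2 * cd r y 1))⁻¹ * a : Fˣ) : F) •
        X F r (sEps1 r y) := by
  unfold T0op
  rw [mkOp_X]
  unfold T0el nabla0eEl nabla0oEl
  rw [ha]
  have hs := sEps1_sub r hr y
  have hE : floorE (-2 * cd r y 1) = 2 * 0 :=
    floorE_val 0 (by push_cast; linarith) (by push_cast; linarith)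
  rw [hE]
  simp only [mul_zero, neg_zero, Int.zero_ediv, geomS_zero, zero_mul, smul_zero, add_zero]
  rcases h0.lt_or_eq with h | h
  · have hO : floorO (-2 * cd r y 1) = 2 * 0 - 1 :=
      floorO_val 0 (by push_cast; linarith) (by push_cast; linarith)
    rw [hO, show (-(2 * 0 - 1 : ℤ) - 1) / 2 = 0 by norm_num, geomS_zero]
    rcases h1.lt_or_eq with h' | h'
    · rw [chiE_not (m := -1) (by push_cast; linarith) (by push_cast; linarith),
        chiO_not (m := -1) (by push_cast; linarith) (by push_cast; linarith)]
      simp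
    · rw [h', mul_zero, chiE_zero, chiO_zero]; simp
  · have hO : floorO (-2 * cd r y 1) = 2 * 1 - 1 :=
      floorO_val 1 (by push_cast; linarith) (by push_cast; linarith)
    rw [hO]
    have e : 2 * cd r y 1 = -1 := by linarith
    rw [e] at hs ⊢
    rw [show (-(2 * 1 - 1 : ℤ) - 1) / 2 = -1 by norm_num, geomS_neg_one, chiE_neg, chiO_neg,
      chiE_one, chiO_one, hq h.symm, mul_neg, neg_mul, smul_mul_smul_comm, smul_mul_assoc,
      X_mul, X_mul, smul_neg,
      show ((-1 : ℝ) • epsV r 1 + -((-2 : ℝ) • epsV r 1) + y) = sEps1 r y by rw [hs]; module,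
      ← sub_eq_add_neg, smul_smul, ← sub_smul]
    congr 1
    have := qh.ne_zero
    have := u0.ne_zero
    push_cast
    field_simp
    ring


/-! ### Moving one coordinate through the others -/

/-- The coordinates of `c` with the coordinate at (0-based) place `i` removed. -/
def dd (c : E r) (i p : ℕ) : ℝ := if p < i then cd r c (p + 1) else cd r c (p + 2)

/-- The vector obtained from `c` by removing the coordinate at place `i` and inserting `v` at
place `p`. -/
def Vec (c : E r) (i : ℕ) (v : ℝ) (p : ℕ) : E r := fun m =>
  if (m : ℕ) < p then dd r c i m else if (m : ℕ) = p then v else dd r c i ((m : ℕ) - 1)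

lemma cd_Vec_at (c : E r) (i : ℕ) (v : ℝ) (p : ℕ) (hp : p < r) :
    cd r (Vec r c i v p) (p + 1) = v := by
  rw [cd_eq' r _ p hp]; simp [Vec]

lemma cd_Vec_succ (c : E r) (i : ℕ) (v : ℝ) (p : ℕ) (hp : p + 1 < r) :
    cd r (Vec r c i v p) (p + 2) = dd r c i p := by
  rw [cd_eq' r _ (p + 1) hp]; simp [Vec]

lemma cd_Vec_pred (c : E r) (i : ℕ) (v : ℝ) (p : ℕ) (hp : p < r) :
    cd r (Vec r c i v (p + 1)) (p + 1) = dd r c i p := by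
  rw [cd_eq' r _ p hp]; simp [Vec]

lemma sW_Vec_up (c : E r) (i : ℕ) (v : ℝ) (p : ℕ) (hp : p + 1 < r) :
    sW r (p + 1) (Vec r c i v p) = Vec r c i v (p + 1) := by
  funext m
  unfold sW
  rw [if_neg (by omega), cd_Vec_at r c i v p (by omega), cd_Vec_succ r c i v p hp]
  unfold Vec
  by_cases h1 : (m : ℕ) = p
  · simp [h1]
  · by_cases h2 : (m : ℕ) = p + 1
    · simp [h2]
    · by_cases h3 : (m : ℕ) < p
      · have : (m : ℕ) < p + 1 := by omega
        simp [h1, h2, h3, this]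
      · have : ¬ (m : ℕ) < p + 1 := by omega
        simp [h1, h2, h3, this]

lemma sW_Vec_down (c : E r) (i : ℕ) (v : ℝ) (p : ℕ) (hp : p + 1 < r) :
    sW r (p + 1) (Vec r c i v (p + 1)) = Vec r c i v p := by
  rw [← sW_Vec_up r c i v p hp, ← genF_pos r _ (by omega), ← genF_pos r _ (by omega),
    genF_invol r _ (by omega)]

lemma sW_Vec_last (c : E r) (i : ℕ) (v : ℝ) (hr : 1 ≤ r) :
    sW r r (Vec r c i v (r - 1)) = Vec r c i (-v) (r - 1) := by
  funext m
  rw [sW_last]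
  unfold Vec
  by_cases h : (m : ℕ) + 1 = r
  · have : (m : ℕ) = r - 1 := by omega
    rw [if_pos h]; simp [this]
  · have : (m : ℕ) < r - 1 := by omega
    rw [if_neg h]; simp [this]

lemma sEps1_Vec (c : E r) (i : ℕ) (v : ℝ) :
    sEps1 r (Vec r c i v 0) = Vec r c i (-v) 0 := by
  funext m
  unfold sEps1 Vec
  by_cases h : (m : ℕ) = 0
  · simp [h]
  · simp [h]

lemma Vec_self (c : E r) (i : ℕ) : Vec r c i (cd r c (i + 1)) i = c := by
  funext m
  unfold Vec dd
  by_cases h : (m : ℕ) < i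
  · simp [h, cd_eq]
  · by_cases h' : (m : ℕ) = i
    · rw [if_neg h, if_pos h', ← h', cd_eq]
    · rw [if_neg h, if_neg h', if_neg (by omega), show (m : ℕ) - 1 + 2 = (m : ℕ) + 1 by omega,
        cd_eq]

lemma dd_bounds {r : ℕ} {c : E r} (hc : c ∈ CplusCl r) (i p : ℕ) (hp : p + 1 < r) :
    0 ≤ dd r c i p ∧ dd r c i p ≤ 1 / 2 := by
  unfold dd
  split_ifs
  · rw [cd_eq' r c p (by omega)]; exact hc.2 _
  · rw [cd_eq' r c (p + 1) (by omega)]; exact hc.2 _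

lemma dd_lt {r : ℕ} {c : E r} (hc : c ∈ CplusCl r) (i p : ℕ) (hi : i < r) (hp : p < i) :
    cd r c (i + 1) ≤ dd r c i p := by
  unfold dd
  rw [if_pos hp, cd_eq' r c p (by omega), cd_eq' r c i hi]
  exact hc.1 _ _ (Fin.mk_le_mk.2 (by omega))

lemma dd_ge {r : ℕ} {c : E r} (hc : c ∈ CplusCl r) (i p : ℕ) (hp' : p + 1 < r) (hp : i ≤ p) :
    dd r c i p ≤ cd r c (i + 1) := by
  unfold dd
  rw [if_neg (by omega), cd_eq' r c (p + 1) hp', cd_eq' r c i (by omega)]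
  exact hc.1 _ _ (Fin.mk_le_mk.2 (by omega))

lemma chain1 {V : Type*} [AddCommGroup V] [Module F V] (f : ℕ → Module.End F V) (v : ℕ → V)
    (a : ℕ → Fˣ) (N : ℕ) (h : ∀ m < N, f m (v (m + 1)) = ((a m : Fˣ) : F) • v m) :
    ((List.range N).map f).prod (v N) = ((∏ m ∈ Finset.range N, a m : Fˣ) : F) • v 0 := by
  induction N with
  | zero => simp
  | succ N ih =>
    rw [List.range_succ, List.map_append, List.prod_append, Finset.prod_range_succ]
    simp only [List.map_cons, List.map_nil, List.prod_singleton, Module.End.mul_apply]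
    rw [h N (by omega), map_smul, ih (fun m hm => h m (by omega)), smul_smul, Units.val_mul,
      mul_comm]

lemma chain2 {V : Type*} [AddCommGroup V] [Module F V] (f : ℕ → Module.End F V) (v : ℕ → V)
    (a : ℕ → Fˣ) (N : ℕ) (h : ∀ m < N, f m (v m) = ((a m : Fˣ) : F) • v (m + 1)) :
    ((List.range N).map f).reverse.prod (v 0)
      = ((∏ m ∈ Finset.range N, a m : Fˣ) : F) • v N := by
  induction N with
  | zero => simp
  | succ N ih =>
    rw [List.range_succ, List.map_append, List.reverse_append, List.prod_append,
      Finset.prod_range_succ]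
    simp only [List.map_cons, List.map_nil, List.reverse_singleton, List.prod_singleton,
      Module.End.mul_apply]
    rw [ih (fun m hm => h m (by omega)), map_smul, h N (by omega), smul_smul, Units.val_mul]

/-- `T_{j+1}⁻¹` -/
lemma Tinv_val (qh k0 u0 k kr ur : Fˣ) (t : Fin r → Fˣ) (j : ℕ) (hj : j + 1 < r) (y : E r)
    (h0 : 0 ≤ cd r y (j + 2) - cd r y (j + 1)) (h1 : cd r y (j + 2) - cd r y (j + 1) < 1) :
    TfullInv F r qh k0 u0 (k : F) kr ur t (j + 1) (X F r y) =
      ((k ^ (eta (cd r y (j + 2) - cd r y (j + 1))) : Fˣ) : F) • X F r (sW r (j + 1) y) := by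
  unfold TfullInv Tfull kpar
  rw [if_neg (by omega), if_neg (by omega), if_neg (by omega)]
  rw [LinearMap.sub_apply, LinearMap.smul_apply, Module.End.one_apply]
  rcases h0.lt_or_eq with h | h
  · rw [T_down F r k kr ur j hj y (by linarith) (by linarith),
      chiZ_not (m := -1) (by push_cast; linarith) (by push_cast; linarith),
      eta_not (m := 0) (by push_cast; linarith) (by push_cast; linarith)]
    simp
  · have e : cd r y (j + 1) - cd r y (j + 2) = 0 := by linarith
    have hs : sW r (j + 1) y = y := by
      rw [sW_eq_sub r y j hj, e]; simp
    rw [T_up F r k kr ur j hj y (by linarith) (by linarith), ← h, e, eta_zero, hs, ← sub_smul]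
    simp

lemma Tfull_pos (qh : Fˣ) (k0 u0 k kr ur : F) (t : Fin r → Fˣ) (j : ℕ) :
    Tfull F r qh k0 u0 k kr ur t (j + 1) = Top F r k kr ur (j + 1) := by
  unfold Tfull; rw [if_neg (by omega)]

lemma nO_eq (c : E r) (i b : ℕ) (hb : r = i + 1 + b) (hi : i < r) :
    nO r c ⟨i, hi⟩ =
      (∑ m ∈ Finset.range b, (eta (cd r c (i + 1) - dd r c i (i + m)) +
        eta (cd r c (i + 1) + dd r c i (i + m)))) +
      ∑ m ∈ Finset.range i, (eta (dd r c i m + cd r c (i + 1)) -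
        eta (dd r c i m - cd r c (i + 1))) := by
  have hv : c ⟨i, hi⟩ = cd r c (i + 1) := (cd_eq' r c i hi).symm
  unfold nO
  rw [hv]
  congr 1
  · have h1 : ∀ j : Fin r, (if (⟨i, hi⟩ : Fin r) < j then
        eta (cd r c (i + 1) - c j) + eta (cd r c (i + 1) + c j) else 0) =
        (fun n : ℕ => if i < n then eta (cd r c (i + 1) - cd r c (n + 1)) +
          eta (cd r c (i + 1) + cd r c (n + 1)) else 0) (j : ℕ) := by
      intro j
      simp only [cd_eq, Fin.lt_def]
    rw [Finset.sum_congr rfl (fun j _ => h1 j), Fin.sum_univ_eq_sum_range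
      (fun n : ℕ => if i < n then eta (cd r c (i + 1) - cd r c (n + 1)) +
          eta (cd r c (i + 1) + cd r c (n + 1)) else 0) r]
    have h2 : Finset.range r = Finset.range (i + 1 + b) := by rw [← hb]
    rw [h2, Finset.sum_range_add, Finset.sum_eq_zero, zero_add]
    · refine Finset.sum_congr rfl (fun m _ => ?_)
      unfold dd
      rw [if_pos (by omega), if_neg (by omega), show i + 1 + m + 1 = i + m + 2 by omega]
    · intro n hn
      rw [if_neg]
      have := Finset.mem_range.1 hn
      omega
  · have h1 : ∀ j : Fin r, (if j < (⟨i, hi⟩ : Fin r) then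
        eta (c j + cd r c (i + 1)) - eta (c j - cd r c (i + 1)) else 0) =
        (fun n : ℕ => if n < i then eta (cd r c (n + 1) + cd r c (i + 1)) -
          eta (cd r c (n + 1) - cd r c (i + 1)) else 0) (j : ℕ) := by
      intro j
      simp only [cd_eq, Fin.lt_def]
    rw [Finset.sum_congr rfl (fun j _ => h1 j), Fin.sum_univ_eq_sum_range
      (fun n : ℕ => if n < i then eta (cd r c (n + 1) + cd r c (i + 1)) -
          eta (cd r c (n + 1) - cd r c (i + 1)) else 0) r]
    have h2 : Finset.range r = Finset.range (i + (1 + b)) := by rw [← add_assoc, ← hb]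
    rw [h2, Finset.sum_range_add, add_eq_left.2]
    · refine Finset.sum_congr rfl (fun m hm => ?_)
      have := Finset.mem_range.1 hm
      unfold dd
      rw [if_pos this, if_pos this]
    · refine Finset.sum_eq_zero (fun n hn => ?_)
      rw [if_neg (by omega)]

lemma prod_zpow_range (k : Fˣ) (e : ℕ → ℤ) (N : ℕ) :
    ∏ m ∈ Finset.range N, k ^ e m = k ^ ∑ m ∈ Finset.range N, e m := by
  induction N with
  | zero => simp
  | succ N ih => rw [Finset.prod_range_succ, Finset.sum_range_succ, ih, zpow_add]

/-- Part (2). -/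
lemma Y_eig (hr : 2 ≤ r)
    (qh k0 u0 k kr ur : Fˣ) (O : Set (E r)) (hO : IsOrbit r O)
    (t : Fin r → Fˣ) (ht : t ∈ TOset F r qh O) (i : ℕ) (hi : i < r) :
    Yop F r qh (k0 : F) (u0 : F) (k : F) (kr : F) (ur : F) t (i + 1) (X F r (cpt r O))
        = (((tcU F r (fun m => sOtor F r k0 u0 k kr ur O m * t m) (i + 1))⁻¹ : Fˣ) : F) •
            X F r (cpt r O) := by
  obtain ⟨hcO, hc⟩ := cpt_spec hO
  obtain ⟨b, hb⟩ : ∃ b, r = i + 1 + b := ⟨r - (i + 1), by omega⟩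
  set c := cpt r O with hcdef
  set v := cd r c (i + 1) with hv
  have hvc : c ⟨i, hi⟩ = v := (cd_eq' r c i hi).symm
  have hv0 : 0 ≤ v := by rw [← hvc]; exact (hc.2 _).1
  have hv1 : v ≤ 1 / 2 := by rw [← hvc]; exact (hc.2 _).2
  have hself : Vec r c i v i = c := Vec_self r c i
  -- membership in the orbit
  have hgen : ∀ (j : ℕ) (z : E r), 1 ≤ j → j ≤ r → z ∈ O → sW r j z ∈ O := by
    intro j z h1 h2 hz
    rw [orbit_eq hO hcO] at hz ⊢
    rw [← genF_pos r j h1]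
    exact orbit_Wd (Wd.gen (b := 0) j (by omega) h2) hz
  have hm1 : ∀ n, i + n < r → Vec r c i v (i + n) ∈ O := by
    intro n
    induction n with
    | zero => intro _; rw [add_zero, hself]; exact hcO
    | succ n ih =>
      intro h
      have := hgen (i + n + 1) _ (by omega) (by omega) (ih (by omega))
      rwa [sW_Vec_up r c i v (i + n) h] at this
  have hm2 : Vec r c i (-v) (r - 1) ∈ O := by
    rw [← sW_Vec_last r c i v (by omega)]
    refine hgen r _ (by omega) le_rfl ?_
    have := hm1 b (by omega)
    rwa [show i + b = r - 1 by omega] at this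
  have hm3 : ∀ n, n ≤ r - 1 → Vec r c i (-v) (r - 1 - n) ∈ O := by
    intro n
    induction n with
    | zero => intro _; exact hm2
    | succ n ih =>
      intro h
      have := hgen (r - 1 - (n + 1) + 1) _ (by omega) (by omega) (ih (by omega))
      rw [show r - 1 - n = r - 1 - (n + 1) + 1 by omega,
        sW_Vec_down r c i (-v) _ (by omega)] at this
      exact this
  have hm4 : Vec r c i (-v) 0 ∈ O := by
    have := hm3 (r - 1) le_rfl
    rwa [Nat.sub_self] at this
  -- first step: move the coordinate to the last place
  have s1 := chain1 F (fun m => Tfull F r qh (k0 : F) u0 k kr ur t (r - 1 - m))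
    (fun m => X F r (Vec r c i v (r - 1 - m)))
    (fun m => k ^ (-eta (v - dd r c i (r - 2 - m)))) b (by
      intro m hm
      have e : r - 1 - m = r - 2 - m + 1 := by omega
      have e' : r - 1 - (m + 1) = r - 2 - m := by omega
      have hp : r - 2 - m + 1 < r := by omega
      have hd := dd_bounds hc i (r - 2 - m) hp
      have hg := dd_ge hc i (r - 2 - m) hp (by omega)
      have := T_up F r k kr ur (r - 2 - m) hp (Vec r c i v (r - 2 - m))
      rw [cd_Vec_at r c i v _ (by omega), cd_Vec_succ r c i v _ hp, sW_Vec_up r c i v _ hp] at this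
      simp only [e, e', Tfull_pos]
      exact this (by linarith) (by linarith))
  -- second step: `T_r`
  have s2 := T_last_up F r (by omega) k kr ur (Vec r c i v (r - 1))
  have e2 : cd r (Vec r c i v (r - 1)) r = v := by
    have := cd_Vec_at r c i v (r - 1) (by omega)
    rwa [show r - 1 + 1 = r by omega] at this
  rw [e2, sW_Vec_last r c i v (by omega)] at s2
  replace s2 := s2 hv0 hv1
  -- third step: move to the first place
  have s3 := chain1 F (fun m => Tfull F r qh (k0 : F) u0 k kr ur t (m + 1))
    (fun m => X F r (Vec r c i (-v) m))
    (fun m => k ^ (-eta (dd r c i m + v))) (r - 1) (by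
      intro m hm
      have hp : m + 1 < r := by omega
      have hd := dd_bounds hc i m hp
      have := T_up F r k kr ur m hp (Vec r c i (-v) (m + 1))
      rw [cd_Vec_pred r c i _ m (by omega), cd_Vec_at r c i _ (m + 1) hp,
        sW_Vec_down r c i _ _ hp, sub_neg_eq_add] at this
      simp only [Tfull_pos]
      exact this (by linarith) (by linarith))
  -- fourth step: `T_0`
  have ev : Vec r c i (-v) 0 ⟨0, by omega⟩ = -c ⟨i, hi⟩ := by rw [hvc]; simp [Vec]
  have htor : tcU F r (torusAct F r qh (gfun r (Vec r c i (-v) 0)) t) 1 = (t ⟨i, hi⟩)⁻¹ := by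
    have := tcU_eq' F r (torusAct F r qh (gfun r (Vec r c i (-v) 0)) t) 0 (by omega)
    rw [zero_add] at this
    rw [this]
    exact torus_val hO ht hm4 _ _ ev
  have s4 := T0_val F r (by omega) qh k0 u0 t (Vec r c i (-v) 0) (t ⟨i, hi⟩)⁻¹
  have e4 := cd_Vec_at r c i (-v) 0 (by omega)
  rw [zero_add] at e4
  rw [e4, sEps1_Vec, neg_neg, mul_neg, chiE_neg, chiO_neg] at s4
  replace s4 := s4 (by linarith) (by linarith) htor (by
    intro h
    rw [TO_half hO ht ⟨i, hi⟩ (by rw [← hcdef, hvc]; linarith)])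
  -- fifth step: the inverses
  have s5 := chain2 F (fun m => TfullInv F r qh (k0 : F) u0 k kr ur t (m + 1))
    (fun m => X F r (Vec r c i v m))
    (fun m => k ^ (eta (dd r c i m - v))) i (by
      intro m hm
      have hp : m + 1 < r := by omega
      have hd := dd_bounds hc i m hp
      have hl := dd_lt hc i m hi hm
      have := Tinv_val F r qh k0 u0 k kr ur t m hp (Vec r c i v m)
      rw [cd_Vec_succ r c i _ m hp, cd_Vec_at r c i _ m (by omega),
        sW_Vec_up r c i _ _ hp] at this
      exact this (by linarith) (by linarith))
  -- assembling
  unfold Yop Ylist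
  have hT0 : Tfull F r qh (k0 : F) u0 k kr ur t 0 = T0op F r qh k0 u0 t := by
    unfold Tfull; rw [if_pos rfl]
  have hTr : Tfull F r qh (k0 : F) u0 k kr ur t r = Top F r k kr ur r := by
    unfold Tfull; rw [if_neg (by omega)]
  simp only [Nat.add_sub_cancel, List.map_reverse, List.map_map, List.map_cons, List.map_append,
    List.map_nil, List.prod_cons, List.prod_append, List.prod_nil, mul_one, Module.End.mul_apply,
    hT0, hTr]
  rw [show r - (i + 1) = b by omega]
  simp only [show r - 1 - b = i by omega, hself] at s1
  simp only [Function.comp_def]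
  simp only [Nat.sub_zero] at s1
  rw [s1]
  simp only [map_smul]
  rw [s2]
  simp only [map_smul]
  rw [s3]
  simp only [map_smul]
  rw [s4]
  simp only [map_smul]
  rw [s5, hself]
  simp only [smul_smul, ← Units.val_mul]
  congr 2
  rw [tcU_eq' F r _ i hi]
  unfold sOtor
  rw [← hcdef, hvc, nO_eq r c i b hb hi, ← hv]
  rw [prod_zpow_range, prod_zpow_range, prod_zpow_range]
  have q1 : ∑ m ∈ Finset.range b, -eta (v - dd r c i (r - 2 - m)) =
      -∑ m ∈ Finset.range b, eta (v - dd r c i (i + m)) := by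
    rw [Finset.sum_neg_distrib, ← Finset.sum_range_reflect]
    congr 1
    refine Finset.sum_congr rfl (fun m hm => ?_)
    have := Finset.mem_range.1 hm
    rw [show r - 2 - (b - 1 - m) = i + m by omega]
  have q2 : ∑ m ∈ Finset.range (r - 1), -eta (dd r c i m + v) =
      -∑ m ∈ Finset.range i, eta (dd r c i m + v)
        - ∑ m ∈ Finset.range b, eta (v + dd r c i (i + m)) := by
    rw [show r - 1 = i + b by omega, Finset.sum_neg_distrib, Finset.sum_range_add, neg_add,
      sub_eq_add_neg]
    congr 2
    exact Finset.sum_congr rfl (fun m _ => by rw [add_comm])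
  rw [q1, q2, Finset.sum_add_distrib, Finset.sum_sub_distrib]
  simp only [mul_pow, zpow_neg, zpow_natCast, zpow_add, zpow_sub, mul_inv, inv_inv]
  generalize k ^ ∑ x ∈ Finset.range i, eta (dd r c i x + v) = a1
  generalize k ^ ∑ x ∈ Finset.range i, eta (dd r c i x - v) = a2
  generalize k ^ ∑ x ∈ Finset.range b, eta (v - dd r c i (i + x)) = a3
  generalize k ^ ∑ x ∈ Finset.range b, eta (v + dd r c i (i + x)) = a4
  clear_value v c
  ac_rfl


/-! ### Cyclicity -/

lemma geomS_mem (S : Submodule F (QA F r)) (lam : Fin r → ℤ) (y : E r)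
    (h : ∀ n : ℤ, X F r ((n : ℝ) • zc r lam + y) ∈ S) (m : ℤ) :
    geomS F r 1 (zc r lam) m * X F r y ∈ S := by
  unfold geomS
  split_ifs
  · rw [Finset.sum_mul]
    refine Submodule.sum_mem _ (fun n _ => ?_)
    rw [smul_mul_assoc, X_mul]
    exact Submodule.smul_mem _ _ (by simpa using h n)
  · rw [neg_mul, Finset.sum_mul]
    refine Submodule.neg_mem _ (Submodule.sum_mem _ (fun n _ => ?_))
    rw [smul_mul_assoc, X_mul]
    exact Submodule.smul_mem _ _ (by simpa using h (-n - 1))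

lemma X_mem_FO {O : Set (E r)} {y : E r} (hy : y ∈ O) : X F r y ∈ FO F r O :=
  Submodule.subset_span ⟨y, hy, rfl⟩

/-- The operators `T_i` preserve `F[O]`. -/
lemma Top_FO (hr : 2 ≤ r) (k kr ur : F) {O : Set (E r)} (hO : IsOrbit r O) (i : ℕ)
    (h1 : 1 ≤ i) (h2 : i ≤ r) (f : QA F r) (hf : f ∈ FO F r O) :
    Top F r k kr ur i f ∈ FO F r O := by
  have htr : ∀ (lam : Fin r → ℤ) (y : E r), y ∈ O → zc r lam + y ∈ O := by
    intro lam y hy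
    obtain ⟨z, rfl⟩ := hO
    rw [add_comm]
    exact orbit_Wd (g := fun y => y + zc r lam) (Wd_trans r lam) hy
  have hgen : ∀ y ∈ O, sW r i y ∈ O := by
    intro y hy
    obtain ⟨z, rfl⟩ := hO
    rw [← genF_pos r i h1]
    exact orbit_Wd (Wd.gen (b := 0) i (by omega) h2) hy
  have htr' : ∀ (lam : Fin r → ℤ) (y : E r), y ∈ O → ∀ n : ℤ,
      X F r ((n : ℝ) • zc r lam + y) ∈ FO F r O := by
    intro lam y hy n
    have : (n : ℝ) • zc r lam = zc r (fun m => n * lam m) := by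
      funext m; simp [zc]
    rw [this]
    exact X_mem_FO F r (htr _ _ hy)
  induction hf using Submodule.span_induction with
  | mem x hx =>
    obtain ⟨y, hy, rfl⟩ := hx
    rw [Top_X]
    unfold Tel
    split_ifs with hir
    · have e1 : (2 : ℝ) • epsV r r = zc r (fun m => if (m : ℕ) + 1 = r then 2 else 0) := by
        funext m; simp [zc, epsV]
      have e2 : epsV r r = zc r (fun m => if (m : ℕ) + 1 = r then 1 else 0) := by
        funext m; simp [zc, epsV]
      refine Submodule.add_mem _ (Submodule.add_mem _ (Submodule.smul_mem _ _ ?_)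
        (Submodule.smul_mem _ _ ?_)) (Submodule.smul_mem _ _ ?_)
      · have := hgen y hy
        rw [hir] at this
        exact X_mem_FO F r this
      · unfold nablaReEl
        rw [e1]
        exact geomS_mem F r _ _ _ (htr' _ _ hy) _
      · unfold nablaRoEl
        rw [mul_comm (X F r (epsV r r)), mul_assoc, X_mul, e1]
        refine geomS_mem F r _ _ _ (htr' _ _ ?_) _
        rw [e2]
        exact htr _ _ hy
    · refine Submodule.add_mem _ (Submodule.smul_mem _ _ (X_mem_FO F r (hgen y hy)))
        (Submodule.smul_mem _ _ ?_)
      unfold nablaIel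
      have e1 : epsV r i - epsV r (i + 1) = zc r (fun m => (if (m : ℕ) + 1 = i then 1 else 0)
          - (if (m : ℕ) + 1 = i + 1 then 1 else 0)) := by
        funext m; simp [zc, epsV]
      rw [e1]
      exact geomS_mem F r _ _ _ (htr' _ _ hy) _
  | zero => rw [map_zero]; exact Submodule.zero_mem _
  | add x y _ _ hx hy => rw [map_add]; exact Submodule.add_mem _ hx hy
  | smul a x _ hx => rw [map_smul]; exact Submodule.smul_mem _ _ hx

/-- `x^{s_i y}` lies in any subspace containing `x^y` and `T_i x^y`, if `y ∈ [-1/2,1/2]^r`. -/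
lemma X_sW_mem (k kr ur : Fˣ) (S : Submodule F (QA F r)) (i : ℕ)
    (h1 : 1 ≤ i) (h2 : i ≤ r) (y : E r) (hy : ∀ m, -(1 / 2) ≤ y m ∧ y m ≤ 1 / 2)
    (hS : X F r y ∈ S) (hT : Top F r (k : F) kr ur i (X F r y) ∈ S) :
    X F r (sW r i y) ∈ S := by
  rcases Nat.lt_or_ge i r with h | h
  · obtain ⟨j, rfl⟩ : ∃ j, i = j + 1 := ⟨i - 1, by omega⟩
    have a1 := hy ⟨j, by omega⟩
    have a2 := hy ⟨j + 1, h⟩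
    rw [← cd_eq' r y j (by omega)] at a1
    rw [← cd_eq' r y (j + 1) h] at a2
    rcases le_or_gt 0 (cd r y (j + 1) - cd r y (j + 2)) with h' | h'
    · rw [T_up F r k kr ur j h y h' (by linarith)] at hT
      exact (Submodule.smul_mem_iff _ (Units.ne_zero _)).1 hT
    · rw [T_down F r k kr ur j h y (by linarith) h'] at hT
      have := (Submodule.add_mem_iff_left _ (Submodule.smul_mem _ _ hS)).1 hT
      exact (Submodule.smul_mem_iff _ (pow_ne_zero _ k.ne_zero)).1 this
  · obtain rfl : i = r := by omega
    have a1 := hy ⟨i - 1, by omega⟩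
    rw [← cd_eq' i y (i - 1) (by omega), show i - 1 + 1 = i by omega] at a1
    rcases le_or_gt 0 (cd i y i) with h' | h'
    · rw [T_last_up F i h1 k kr ur y h' a1.2] at hT
      exact (Submodule.smul_mem_iff _ (Units.ne_zero _)).1 hT
    · rw [T_last_down F i k kr ur y a1.1 h'] at hT
      have := (Submodule.add_mem_iff_left _ (Submodule.smul_mem _ _ hS)).1 hT
      exact (Submodule.smul_mem_iff _ (mul_ne_zero (pow_ne_zero _ kr.ne_zero)
        (pow_ne_zero _ ur.ne_zero))).1 this

lemma sW_bound (i : ℕ) (h1 : 1 ≤ i) (h2 : i ≤ r) (y : E r)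
    (hy : ∀ m, -(1 / 2) ≤ y m ∧ y m ≤ 1 / 2) (m : Fin r) :
    -(1 / 2) ≤ sW r i y m ∧ sW r i y m ≤ 1 / 2 := by
  rcases Nat.lt_or_ge i r with h | h
  · obtain ⟨j, rfl⟩ : ∃ j, i = j + 1 := ⟨i - 1, by omega⟩
    rw [sW_mid r y j h]
    exact hy _
  · obtain rfl : i = r := by omega
    rw [sW_last]
    have := hy m
    split_ifs
    · constructor <;> linarith
    · exact this

/-- The span of the elements `T_{i₁} ⋯ T_{i_ℓ} x^c`. -/
def NN (k kr ur : F) (c : E r) : Submodule F (QA F r) :=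
  Submodule.span F {g | ∃ l : List ℕ, (∀ a ∈ l, 1 ≤ a ∧ a ≤ r) ∧
    g = applyT F r k kr ur l (X F r c)}

lemma Top_NN (k kr ur : F) (c : E r) (i : ℕ) (h1 : 1 ≤ i) (h2 : i ≤ r) (f : QA F r)
    (hf : f ∈ NN F r k kr ur c) : Top F r k kr ur i f ∈ NN F r k kr ur c := by
  induction hf using Submodule.span_induction with
  | mem x hx =>
    obtain ⟨l, hl, rfl⟩ := hx
    refine Submodule.subset_span ⟨i :: l, fun a ha => ?_, rfl⟩
    rcases List.mem_cons.1 ha with rfl | h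
    · exact ⟨h1, h2⟩
    · exact hl a h
  | zero => rw [map_zero]; exact Submodule.zero_mem _
  | add x y _ _ hx hy => rw [map_add]; exact Submodule.add_mem _ hx hy
  | smul a x _ hx => rw [map_smul]; exact Submodule.smul_mem _ _ hx

lemma X_word_NN (k kr ur : Fˣ) (c : E r) (hc : c ∈ CplusCl r) (l : List ℕ)
    (hl : ∀ a ∈ l, 1 ≤ a ∧ a ≤ r) :
    X F r (wordAct r l c) ∈ NN F r (k : F) kr ur c ∧
      ∀ m, -(1 / 2) ≤ wordAct r l c m ∧ wordAct r l c m ≤ 1 / 2 := by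
  induction l with
  | nil =>
    refine ⟨Submodule.subset_span ⟨[], by simp, rfl⟩, fun m => ?_⟩
    have := hc.2 m
    change -(1 / 2) ≤ c m ∧ c m ≤ 1 / 2
    constructor <;> linarith
  | cons a l ih =>
    obtain ⟨h1, h2⟩ := ih (fun b hb => hl b (by simp [hb]))
    obtain ⟨ha1, ha2⟩ := hl a (by simp)
    rw [wordAct_cons, genF_pos r a ha1]
    exact ⟨X_sW_mem F r k kr ur _ a ha1 ha2 _ h2 h1 (Top_NN F r _ _ _ c a ha1 ha2 _ h1),
      sW_bound r a ha1 ha2 _ h2⟩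

lemma FO_span (hr : 2 ≤ r) (k kr ur : Fˣ) (O : Set (E r)) (hO : IsOrbit r O) :
    (FO F r O = Submodule.span F
      {g | ∃ (lam : Fin r → ℤ) (l : List ℕ), (∀ a ∈ l, 1 ≤ a ∧ a ≤ r) ∧
        g = X F r (zc r lam) *
              applyT F r (k : F) (kr : F) (ur : F) l (X F r (cpt r O))}) := by
  obtain ⟨hcO, hc⟩ := cpt_spec hO
  apply le_antisymm
  · refine Submodule.span_le.2 ?_
    rintro _ ⟨y, hy, rfl⟩
    rw [orbit_eq hO hcO] at hy
    obtain ⟨l0, hl0, hy⟩ := hy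
    obtain ⟨p, s, lam, hs, hf⟩ := word_form r l0 hl0
    obtain ⟨l, hl, hl'⟩ := Wd_signed r p s hs
    have h1 := (X_word_NN F r k kr ur (cpt r O) hc l hl).1
    have h2 : y = zc r lam + wordAct r l (cpt r O) := by
      rw [hl', ← hy]
      funext m
      rw [hf]; simp [zc, add_comm]
    rw [h2, ← X_mul]
    generalize X F r (wordAct r l (cpt r O)) = f at h1
    change X F r (zc r lam) * f ∈ Submodule.span F _
    induction h1 using Submodule.span_induction with
    | mem x hx =>
      obtain ⟨l, hl, rfl⟩ := hx
      exact Submodule.subset_span ⟨lam, l, hl, rfl⟩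
    | zero => rw [mul_zero]; exact Submodule.zero_mem _
    | add x y _ _ hx hy => rw [mul_add]; exact Submodule.add_mem _ hx hy
    | smul a x _ hx => rw [mul_smul_comm]; exact Submodule.smul_mem _ _ hx
  · refine Submodule.span_le.2 ?_
    rintro _ ⟨lam, l, hl, rfl⟩
    have h1 : applyT F r (k : F) (kr : F) (ur : F) l (X F r (cpt r O)) ∈ FO F r O := by
      induction l with
      | nil => exact X_mem_FO F r hcO
      | cons a l ih =>
        exact Top_FO F r hr k kr ur hO a (hl a (by simp)).1 (hl a (by simp)).2 _
          (ih (fun b hb => hl b (by simp [hb])))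
    generalize applyT F r (k : F) (kr : F) (ur : F) l (X F r (cpt r O)) = f at h1
    change X F r (zc r lam) * f ∈ FO F r O
    induction h1 using Submodule.span_induction with
    | mem x hx =>
      obtain ⟨y, hy, rfl⟩ := hx
      rw [X_mul]
      apply X_mem_FO
      obtain ⟨z, rfl⟩ := hO
      rw [add_comm]
      exact orbit_Wd (g := fun y => y + zc r lam) (Wd_trans r lam) hy
    | zero => rw [mul_zero]; exact Submodule.zero_mem _
    | add x y _ _ hx hy => rw [mul_add]; exact Submodule.add_mem _ hx hy
    | smul a x _ hx => rw [mul_smul_comm]; exact Submodule.smul_mem _ _ hx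

/-- Part (1). -/
lemma T_fix (hr : 2 ≤ r) (k kr ur : Fˣ) (c : E r) (i : ℕ) (h1 : 1 ≤ i) (h2 : i ≤ r)
    (h : alphaF r i c = 0) :
    Top F r (k : F) (kr : F) (ur : F) i (X F r c)
        = (if i = r then (kr : F) else (k : F)) • X F r c := by
  unfold alphaF at h
  rw [if_neg (by omega)] at h
  rcases Nat.lt_or_ge i r with h' | h'
  · obtain ⟨j, rfl⟩ : ∃ j, i = j + 1 := ⟨i - 1, by omega⟩
    rw [if_neg (by omega)] at h ⊢
    have hs := sW_eq_sub r c j h'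
    have h : cd r c (j + 1) - cd r c (j + 2) = 0 := h
    rw [T_up F r k kr ur j h' c (by linarith) (by linarith), hs, h, eta_zero]
    simp
  · obtain rfl : i = r := by omega
    rw [if_pos rfl] at h ⊢
    have hs := sW_last_sub i h1 c
    rw [T_last_up F i h1 k kr ur c (by linarith) (by linarith), hs, h, chiE_zero, chiO_zero]
    simp


/-- `x^{c^𝒪}` is a cyclic vector of the quasi-polynomial
representation: `T_i^𝒪(x^{c^𝒪}) = k_i x^{c^𝒪}` when `α_i(c^𝒪) = 0`,
`Y_i^𝒪(x^{c^𝒪}) = ((𝔰^𝒪 t)_i)⁻¹ x^{c^𝒪}`, and `F[𝒪]` is spanned by the elements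
`x^λ · T_{i₁}(⋯(T_{i_ℓ}(x^{c^𝒪}))⋯)`. -/
theorem statement12 (F : Type*) [Field F] [CharZero F] (r : ℕ) (hr : 2 ≤ r)
    (qh k0 u0 k kr ur : Fˣ) (O : Set (E r)) (hO : IsOrbit r O)
    (t : Fin r → Fˣ) (ht : t ∈ TOset F r qh O) :
    (∀ i : ℕ, 1 ≤ i → i ≤ r → alphaF r i (cpt r O) = 0 →
      Top F r (k : F) (kr : F) (ur : F) i (X F r (cpt r O))
        = (if i = r then (kr : F) else (k : F)) • X F r (cpt r O)) ∧
    (∀ i : ℕ, 1 ≤ i → i ≤ r →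
      Yop F r qh (k0 : F) (u0 : F) (k : F) (kr : F) (ur : F) t i (X F r (cpt r O))
        = (((tcU F r (fun m => sOtor F r k0 u0 k kr ur O m * t m) i)⁻¹ : Fˣ) : F) •
            X F r (cpt r O)) ∧
    (FO F r O = Submodule.span F
      {g | ∃ (lam : Fin r → ℤ) (l : List ℕ), (∀ a ∈ l, 1 ≤ a ∧ a ≤ r) ∧
        g = X F r (zc r lam) *
              applyT F r (k : F) (kr : F) (ur : F) l (X F r (cpt r O))}) := by
  refine ⟨fun i h1 h2 h => T_fix F r hr k kr ur _ i h1 h2 h, fun i h1 h2 => ?_,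
    FO_span F r hr k kr ur O hO⟩
  obtain ⟨j, rfl⟩ : ∃ j, i = j + 1 := ⟨i - 1, by omega⟩
  exact Y_eig F r hr qh k0 u0 k kr ur O hO t ht j (by omega)

end QP

end
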